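/- arXiv:0811.1715 — 2 statements merged into one kernel-verified Lean document; each statement's English description precedes it below -/
import Mathlib

section
/- Polynomials are dense in the Bergman space of G: for every function f holomorphic on G with ∫_G |f|² dA < ∞ and every ε > 0, there exists a polynomial p with ∫_G |f − p|² dA < ε. -/
open MeasureTheory Filter Polynomial Set Metric

noncomputable section

/-- A Jordan curve: the range of an injective continuous map from the unit circle into `ℂ`. -/
def IsJordanCurve (C : Set ℂ) : Prop :=
  ∃ f : ℂ → ℂ, ContinuousOn f (sphere (0:ℂ) 1) ∧ InjOn f (sphere (0:ℂ) 1) ∧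
    C = f '' sphere (0:ℂ) 1

/-- A Jordan domain: the bounded connected component of the complement of a Jordan curve. -/
def IsJordanDomain (D : Set ℂ) : Prop :=
  ∃ C : Set ℂ, IsJordanCurve C ∧ Bornology.IsBounded D ∧
    ∃ z ∈ Cᶜ, D = connectedComponentIn Cᶜ z

/-- An archipelago: a finite family of Jordan domains with mutually disjoint closures. -/
def IsArchipelago {N : ℕ} (Gs : Fin N → Set ℂ) : Prop :=
  (∀ j, IsJordanDomain (Gs j)) ∧
  ∀ j k, j ≠ k → Disjoint (closure (Gs j)) (closure (Gs k))

/-- `P n` is the Bergman orthonormal polynomial of degree `n` for `G`, with positive real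
leading coefficient `lam n`, and the family is orthonormal in `L²(G, dA)`. -/
def IsBergmanSystem (G : Set ℂ) (P : ℕ → Polynomial ℂ) (lam : ℕ → ℝ) : Prop :=
  (∀ n, (P n).natDegree = n) ∧
  (∀ n, 0 < lam n ∧ (P n).leadingCoeff = (lam n : ℂ)) ∧
  ∀ n k, (∫ z in G, (P n).eval z * (starRingEnd ℂ) ((P k).eval z)) =
    if n = k then 1 else 0

/-! ### Continuous logarithms and separation of the plane -/

/-- A nowhere vanishing continuous function on a simply connected space has a continuous
logarithm. -/
lemma exists_continuousMap_exp_eq {X : Type*} [TopologicalSpace X] [SimplyConnectedSpace X]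
    [LocallyPathConnectedSpace X] (g : C(X, ℂ)) (hg : ∀ x, g x ≠ 0) :
    ∃ l : C(X, ℂ), ∀ x, Complex.exp (l x) = g x := by
  have : Nonempty X := inferInstance
  obtain ⟨x₀⟩ := this
  obtain ⟨f, ⟨-, hf⟩, -⟩ := Complex.isCoveringMapOn_exp.existsUnique_continuousMap_lifts
    g (Complex.exp_log (hg x₀)) (fun x ↦ hg x)
  exact ⟨f, fun x ↦ congrFun hf x⟩

/-- If `exp ∘ h` is constant along `ℝ`, so is the continuous function `h`. -/
lemma eq_of_exp_eq_one {h : ℝ → ℂ} (hc : Continuous h) (h1 : ∀ t, Complex.exp (h t) = 1)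
    (s t : ℝ) : h s = h t := by
  have hperiod : ∀ t, ∃ n : ℤ, h t = n * (2 * Real.pi * Complex.I) := fun t ↦
    Complex.exp_eq_one_iff.1 (h1 t)
  have hpi : (2 * Real.pi * Complex.I : ℂ) ≠ 0 := Complex.two_pi_I_ne_zero
  choose n hn using hperiod
  have hre : ∀ t, (h t / (2 * Real.pi * Complex.I)).re = n t := fun t ↦ by
    rw [hn t, mul_div_cancel_right₀ _ hpi, Complex.intCast_re]
  have hnc : Continuous n := by
    rw [Int.isClosedEmbedding_coe_real.isEmbedding.continuous_iff]
    have : ((↑) : ℤ → ℝ) ∘ n = fun t ↦ (h t / (2 * Real.pi * Complex.I)).re := by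
      ext t; simp [hre]
    rw [this]
    exact Complex.continuous_re.comp (hc.div_const _)
  rw [hn s, hn t, PreconnectedSpace.constant inferInstance hnc (x := s) (y := t)]

/-- A nowhere vanishing continuous function on the plane cannot agree with `(z - a) ^ n` on a
circle about `a`, unless `n = 0`. -/
lemma eq_zero_of_eqOn_sphere_zpow {F : ℂ → ℂ} (hF : Continuous F) (h0 : ∀ z, F z ≠ 0)
    {a : ℂ} {R : ℝ} (hR : 0 < R) {n : ℤ}
    (hFa : ∀ z ∈ sphere a R, F z = (z - a) ^ n) : n = 0 := by
  obtain ⟨l, hl⟩ := exists_continuousMap_exp_eq ⟨F, hF⟩ h0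
  let h : ℝ → ℂ := fun t ↦ l (a + R * Complex.exp (t * Complex.I))
    - n * (Real.log R + t * Complex.I)
  have hc : Continuous h := by
    have := l.continuous
    fun_prop
  have h1 : ∀ t, Complex.exp (h t) = 1 := by
    intro t
    have hmem : a + R * Complex.exp (t * Complex.I) ∈ sphere a R := by
      simp [Complex.norm_exp_ofReal_mul_I, abs_of_pos hR]
    have : Complex.exp (l (a + R * Complex.exp (t * Complex.I)))
        = Complex.exp (n * (Real.log R + t * Complex.I)) := by
      rw [hl, Complex.exp_int_mul, Complex.exp_add, ← Complex.ofReal_exp, Real.exp_log hR]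
      simpa using hFa _ hmem
    simp only [h, Complex.exp_sub, this]
    exact div_self (Complex.exp_ne_zero _)
  have key := eq_of_exp_eq_one hc h1 0 (2 * Real.pi)
  have hper : Complex.exp (((2 * Real.pi : ℝ) : ℂ) * Complex.I) = 1 := by
    simp [Complex.exp_two_pi_mul_I]
  simp only [h, hper] at key
  simp at key
  exact key

lemma isPreconnected_compl_closedBall_zero {R : ℝ} (hR : 0 < R) :
    IsPreconnected (closedBall (0 : ℂ) R)ᶜ := by
  have : (closedBall (0 : ℂ) R)ᶜ = Complex.exp '' {w | Real.log R < w.re} := by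
    ext z
    simp only [mem_compl_iff, mem_closedBall_zero_iff, not_le, mem_image, mem_ofPred_eq]
    constructor
    · intro hz
      have hz0 : z ≠ 0 := norm_pos_iff.1 (hR.trans hz)
      exact ⟨Complex.log z, by rw [Complex.log_re]; exact Real.log_lt_log hR hz,
        Complex.exp_log hz0⟩
    · rintro ⟨w, hw, rfl⟩
      rw [Complex.norm_exp, ← Real.log_lt_iff_lt_exp hR]
      exact hw
  rw [this]
  exact ((convex_halfSpace_re_gt _).isPreconnected).image _ Complex.continuous_exp.continuousOn

/-- Outside a compact set of the plane, all components which are not bounded coincide. -/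
lemma compl_closedBall_subset_connectedComponentIn {K : Set ℂ} {R : ℝ} (hR : 0 < R)
    (hK : K ⊆ closedBall 0 R) {z : ℂ}
    (hz : ¬ Bornology.IsBounded (connectedComponentIn Kᶜ z)) :
    (closedBall 0 R)ᶜ ⊆ connectedComponentIn Kᶜ z := by
  have : ¬ connectedComponentIn Kᶜ z ⊆ closedBall 0 R := fun h ↦
    hz (isBounded_closedBall.subset h)
  obtain ⟨w, hw, hwR⟩ := not_subset.1 this
  rw [connectedComponentIn_eq hw]
  exact (isPreconnected_compl_closedBall_zero hR).subset_connectedComponentIn hwR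
    (compl_subset_compl.2 hK)

lemma exists_pos_subset_closedBall {K : Set ℂ} (hK : Bornology.IsBounded K) :
    ∃ R : ℝ, 0 < R ∧ K ⊆ closedBall 0 R := by
  obtain ⟨R, hR⟩ := hK.subset_closedBall 0
  exact ⟨max R 1, by positivity, hR.trans (closedBall_subset_closedBall (le_max_left _ _))⟩

lemma connectedComponentIn_eq_of_not_isBounded {K : Set ℂ} (hK : Bornology.IsBounded K) {z w : ℂ}
    (hz : ¬ Bornology.IsBounded (connectedComponentIn Kᶜ z))
    (hw : ¬ Bornology.IsBounded (connectedComponentIn Kᶜ w)) :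
    connectedComponentIn Kᶜ z = connectedComponentIn Kᶜ w := by
  obtain ⟨R, hR, hKR⟩ := exists_pos_subset_closedBall hK
  have hmem : ((R + 1 : ℝ) : ℂ) ∈ (closedBall (0 : ℂ) R)ᶜ := by
    simp only [mem_compl_iff, mem_closedBall_zero_iff, Complex.norm_real, Real.norm_eq_abs, not_le]
    rw [abs_of_pos (by linarith)]
    linarith
  rw [connectedComponentIn_eq (compl_closedBall_subset_connectedComponentIn hR hKR hz hmem),
    connectedComponentIn_eq (compl_closedBall_subset_connectedComponentIn hR hKR hw hmem)]

lemma isPreconnected_compl_of_forall_not_isBounded {K : Set ℂ} (hK : Bornology.IsBounded K)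
    (h : ∀ z ∈ Kᶜ, ¬ Bornology.IsBounded (connectedComponentIn Kᶜ z)) : IsPreconnected Kᶜ := by
  rcases Kᶜ.eq_empty_or_nonempty with h0 | ⟨z, hz⟩
  · exact h0 ▸ isPreconnected_empty
  have : Kᶜ = connectedComponentIn Kᶜ z := by
    refine Subset.antisymm (fun w hw ↦ ?_) (connectedComponentIn_subset _ _)
    rw [connectedComponentIn_eq_of_not_isBounded hK (h z hz) (h w hw)]
    exact mem_connectedComponentIn hw
  rw [this]
  exact isPreconnected_connectedComponentIn

lemma frontier_connectedComponentIn_subset {K : Set ℂ} (hK : IsClosed K) (z : ℂ) :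
    frontier (connectedComponentIn Kᶜ z) ⊆ K := by
  intro w hw
  by_contra hwK
  have hopen : IsOpen (connectedComponentIn Kᶜ w) := hK.isOpen_compl.connectedComponentIn
  have hwm : w ∈ connectedComponentIn Kᶜ w := mem_connectedComponentIn hwK
  have hzo : IsOpen (connectedComponentIn Kᶜ z) := hK.isOpen_compl.connectedComponentIn
  obtain ⟨y, hyw, hyz⟩ := mem_closure_iff.1 (frontier_subset_closure hw) _ hopen hwm
  rw [connectedComponentIn_eq hyw, ← connectedComponentIn_eq hyz] at hwm
  exact (hzo.inter_frontier_eq.subset ⟨hwm, hw⟩).elim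

/-- A bounded component of the complement of `K` containing `a` obstructs writing `(z - a) ^ n`
on `K` as `exp L * H` with `H` continuous and zero free on the closed component. -/
lemma eq_zero_of_zpow_eq_exp_mul {K : Set ℂ} (hK : IsClosed K) {a : ℂ}
    (ha : a ∈ Kᶜ) (hb : Bornology.IsBounded (connectedComponentIn Kᶜ a)) {n : ℤ} (L : C(ℂ, ℂ))
    {H : ℂ → ℂ} (hH : ContinuousOn H (closure (connectedComponentIn Kᶜ a)))
    (hH0 : ∀ z ∈ connectedComponentIn Kᶜ a, H z ≠ 0)
    (hL : ∀ z ∈ K, (z - a) ^ n = Complex.exp (L z) * H z) : n = 0 := by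
  classical
  set U := connectedComponentIn Kᶜ a with hU
  have haU : a ∈ U := mem_connectedComponentIn ha
  have hUo : IsOpen U := hK.isOpen_compl.connectedComponentIn
  let F : ℂ → ℂ := U.piecewise (fun z ↦ Complex.exp (L z) * H z) (fun z ↦ (z - a) ^ n)
  have hF : Continuous F := by
    refine continuous_piecewise ?_ ?_ ?_
    · intro z hz
      exact (hL z (frontier_connectedComponentIn_subset hK a hz)).symm
    · exact (Complex.continuous_exp.comp L.continuous).continuousOn.mul hH
    · rw [hUo.isClosed_compl.closure_eq]
      refine ContinuousOn.zpow₀ (by fun_prop) n fun z hz ↦ Or.inl ?_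
      exact sub_ne_zero.2 fun h ↦ hz (h ▸ haU)
  have h0 : ∀ z, F z ≠ 0 := by
    intro z
    by_cases hz : z ∈ U
    · simp only [F, piecewise_eq_of_mem _ _ _ hz]
      exact mul_ne_zero (Complex.exp_ne_zero _) (hH0 z hz)
    · simp only [F, piecewise_eq_of_notMem _ _ _ hz]
      exact zpow_ne_zero _ (sub_ne_zero.2 fun h ↦ hz (h ▸ haU))
  obtain ⟨R, hR⟩ := hb.subset_ball a
  have hRpos : 0 < R := by simpa using hR haU
  refine eq_zero_of_eqOn_sphere_zpow hF h0 hRpos (a := a) fun z hz ↦ ?_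
  have hzU : z ∉ U := fun h ↦ by
    have := hR h
    rw [mem_ball] at this
    rw [mem_sphere] at hz
    linarith
  simp only [F, piecewise_eq_of_notMem _ _ _ hzU]

/-- `K` has a continuous logarithm of `z - a`. -/
def HasLogAt (K : Set ℂ) (a : ℂ) : Prop := ∃ L : C(ℂ, ℂ), ∀ z ∈ K, Complex.exp (L z) = z - a

lemma HasLogAt.not_isBounded {K : Set ℂ} (hK : IsClosed K) {a : ℂ}
    (ha : a ∈ Kᶜ) (h : HasLogAt K a) : ¬ Bornology.IsBounded (connectedComponentIn Kᶜ a) := by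
  intro hb
  obtain ⟨L, hL⟩ := h
  have := eq_zero_of_zpow_eq_exp_mul hK ha hb (n := 1) L (H := fun _ ↦ 1)
    continuousOn_const (by simp) (fun z hz ↦ by simp [hL z hz])
  exact one_ne_zero this

/-- A continuous function factoring through a curve extends continuously to the plane. -/
lemma exists_continuousMap_comp_eqOn_Icc {a b : ℝ} {γ l : ℝ → ℂ} (hγ : Continuous γ)
    (hl : Continuous l)
    (hfac : ∀ s ∈ Icc a b, ∀ t ∈ Icc a b, γ s = γ t → l s = l t) :
    ∃ L : C(ℂ, ℂ), ∀ t ∈ Icc a b, L (γ t) = l t := by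
  let γ' : C(Icc a b, γ '' Icc a b) :=
    ⟨fun t ↦ ⟨γ t, mem_image_of_mem _ t.2⟩, by fun_prop⟩
  have hq : Topology.IsQuotientMap γ' := by
    refine (γ'.continuous.isClosedMap).isQuotientMap γ'.continuous ?_
    rintro ⟨_, t, ht, rfl⟩
    exact ⟨⟨t, ht⟩, rfl⟩
  let l' : C(Icc a b, ℂ) := ⟨fun t ↦ l t, by fun_prop⟩
  have hf : Function.FactorsThrough l' γ' := fun s t hst ↦
    hfac s s.2 t t.2 (congrArg Subtype.val hst)
  have hcl : IsClosed (γ '' Icc a b) := (isCompact_Icc.image hγ).isClosed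
  obtain ⟨L, hL⟩ := ContinuousMap.exists_restrict_eq hcl (hq.lift l' hf)
  refine ⟨L, fun t ht ↦ ?_⟩
  have h1 := congrArg (fun φ : C(γ '' Icc a b, ℂ) ↦ φ (γ' ⟨t, ht⟩)) hL
  have h2 := congrArg (fun φ : C(Icc a b, ℂ) ↦ φ ⟨t, ht⟩) (hq.lift_comp l' hf)
  exact h1.trans h2

/-- An arc does not separate the plane. -/
lemma isPreconnected_compl_arc {a b : ℝ} {γ : ℝ → ℂ} (hγ : Continuous γ)
    (hinj : InjOn γ (Icc a b)) : IsPreconnected (γ '' Icc a b)ᶜ := by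
  have hcomp : IsCompact (γ '' Icc a b) := isCompact_Icc.image hγ
  refine isPreconnected_compl_of_forall_not_isBounded hcomp.isBounded fun w hw ↦ ?_
  refine HasLogAt.not_isBounded hcomp.isClosed hw ?_
  rcases lt_or_ge b a with hab | hab
  · exact ⟨0, by simp [Icc_eq_empty_of_lt hab]⟩
  have hne : ∀ t : ℝ, γ (projIcc a b hab t) - w ≠ 0 := fun t ↦
    sub_ne_zero.2 fun h ↦ hw (h ▸ mem_image_of_mem γ (projIcc a b hab t).2)
  obtain ⟨l, hl⟩ := exists_continuousMap_exp_eq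
    (⟨fun t ↦ γ (projIcc a b hab t) - w, by fun_prop⟩ : C(ℝ, ℂ)) hne
  obtain ⟨L, hL⟩ := exists_continuousMap_comp_eqOn_Icc hγ l.continuous
    (fun s hs t ht hst ↦ congrArg l (hinj hs ht hst))
  refine ⟨L, ?_⟩
  rintro _ ⟨t, ht, rfl⟩
  rw [hL t ht, hl]
  simp [projIcc_of_mem hab ht]

/-! ### Jordan curves -/

lemma IsJordanCurve.exists_param {C : Set ℂ} (hC : IsJordanCurve C) :
    ∃ γ : ℝ → ℂ, Continuous γ ∧ C = range γ ∧
      ∀ s t, γ s = γ t ↔ ∃ n : ℤ, s = t + n * (2 * Real.pi) := by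
  obtain ⟨f, hf, hinj, rfl⟩ := hC
  have hmem : ∀ t : ℝ, Complex.exp (t * Complex.I) ∈ sphere (0 : ℂ) 1 := fun t ↦ by
    simp [Complex.norm_exp_ofReal_mul_I]
  refine ⟨fun t ↦ f (Complex.exp (t * Complex.I)), ?_, ?_, fun s t ↦ ?_⟩
  · exact hf.comp_continuous (by fun_prop) hmem
  · ext w
    constructor
    · rintro ⟨z, hz, rfl⟩
      refine ⟨Complex.arg z, ?_⟩
      have := Complex.norm_mul_exp_arg_mul_I z
      rw [mem_sphere_zero_iff_norm.1 hz] at this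
      simp only [Complex.ofReal_one, one_mul] at this
      simp only [this]
    · rintro ⟨t, rfl⟩
      exact ⟨_, hmem t, rfl⟩
  · constructor
    · intro h
      obtain ⟨n, hn⟩ := Complex.exp_eq_exp_iff_exists_int.1 (hinj (hmem s) (hmem t) h)
      refine ⟨n, ?_⟩
      have := congrArg Complex.im hn
      simpa using this
    · rintro ⟨n, rfl⟩
      have : Complex.exp (((t + n * (2 * Real.pi) : ℝ) : ℂ) * Complex.I)
          = Complex.exp (t * Complex.I) :=
        Complex.exp_eq_exp_iff_exists_int.2 ⟨n, by push_cast; ring⟩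
      simp only [this]

lemma eq_of_eq_add_int_mul_two_pi {s t : ℝ} (h : |s - t| < 2 * Real.pi) {n : ℤ}
    (hn : s = t + n * (2 * Real.pi)) : s = t := by
  have h1 : |(n : ℝ)| < 1 := by
    have : s - t = n * (2 * Real.pi) := by linarith
    rw [this, abs_mul, abs_of_pos Real.two_pi_pos] at h
    have := Real.two_pi_pos
    nlinarith
  have : n = 0 := by
    rw [← Int.abs_lt_one_iff]
    exact_mod_cast h1
  simpa [this] using hn

lemma IsJordanCurve.isCompact {C : Set ℂ} (hC : IsJordanCurve C) : IsCompact C := by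
  obtain ⟨f, hf, -, rfl⟩ := hC
  exact (isCompact_sphere _ _).image_of_continuousOn hf

/-- A component of the complement of a Jordan curve, if it is not the only one, accumulates
at every point of the curve. -/
lemma IsJordanCurve.subset_closure {C : Set ℂ} (hC : IsJordanCurve C) {z w : ℂ} (hz : z ∈ Cᶜ)
    (hw : w ∈ Cᶜ) (hwz : w ∉ connectedComponentIn Cᶜ z) :
    C ⊆ closure (connectedComponentIn Cᶜ z) := by
  have hCc := hC.isCompact.isClosed
  obtain ⟨γ, hγ, rfl, hper⟩ := hC.exists_param
  set U := connectedComponentIn (range γ)ᶜ z with hU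
  have hUo : IsOpen U := hCc.isOpen_compl.connectedComponentIn
  rintro _ ⟨t₀, rfl⟩
  by_contra hp
  have hnhds : γ ⁻¹' (closure U)ᶜ ∈ nhds t₀ :=
    (isClosed_closure.isOpen_compl.preimage hγ).mem_nhds hp
  obtain ⟨η, hη, hball⟩ := nhds_basis_closedBall.mem_iff.1 hnhds
  set A := γ '' Icc (t₀ + η) (t₀ - η + 2 * Real.pi) with hA
  have hAC : A ⊆ range γ := image_subset_range _ _
  have hconn : IsPreconnected Aᶜ := by
    refine isPreconnected_compl_arc hγ fun s hs t ht hst ↦ ?_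
    obtain ⟨n, hn⟩ := (hper s t).1 hst
    refine eq_of_eq_add_int_mul_two_pi ?_ hn
    rw [abs_lt]
    constructor <;> linarith [hs.1, hs.2, ht.1, ht.2]
  have hfr : closure U ∩ Aᶜ ⊆ U := by
    rintro q ⟨hq, hqA⟩
    by_contra hqU
    have hqf : q ∈ frontier U := by rw [hUo.frontier_eq]; exact ⟨hq, hqU⟩
    obtain ⟨s, rfl⟩ := frontier_connectedComponentIn_subset hCc z hqf
    set s' := toIcoMod Real.two_pi_pos (t₀ - η) s with hs'
    have hs'mem : s' ∈ Ico (t₀ - η) (t₀ - η + 2 * Real.pi) :=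
      toIcoMod_mem_Ico Real.two_pi_pos (t₀ - η) s
    have hss' : γ s = γ s' := by
      refine (hper _ _).2 ⟨toIcoDiv Real.two_pi_pos (t₀ - η) s, ?_⟩
      have := toIcoMod_add_toIcoDiv_zsmul Real.two_pi_pos (t₀ - η) s
      rw [zsmul_eq_mul] at this
      exact this.symm
    rw [hss'] at hq hqA
    rcases lt_or_ge s' (t₀ + η) with h | h
    · refine hball ?_ hq
      rw [Real.closedBall_eq_Icc]
      exact ⟨hs'mem.1, h.le⟩
    · exact hqA ⟨s', ⟨h, hs'mem.2.le⟩, rfl⟩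
  have hne : (Aᶜ ∩ U).Nonempty :=
    ⟨z, fun h ↦ hz (hAC h), mem_connectedComponentIn hz⟩
  exact hwz (hconn.subset_of_closure_inter_subset hUo hne hfr fun h ↦ hw (hAC h))

/-- On a Jordan curve, nontrivial powers of `z - a` and `z - b` differ by an exponential. -/
lemma IsJordanCurve.exists_zpow_eq {C : Set ℂ} (hC : IsJordanCurve C) {a b : ℂ} (ha : a ∈ Cᶜ)
    (hb : b ∈ Cᶜ) : ∃ (n m : ℤ) (L : C(ℂ, ℂ)), (n ≠ 0 ∨ m ≠ 0) ∧
      ∀ z ∈ C, (z - a) ^ n = Complex.exp (L z) * (z - b) ^ m := by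
  obtain ⟨γ, hγ, rfl, hper⟩ := hC.exists_param
  have hend : γ (2 * Real.pi) = γ 0 := (hper _ _).2 ⟨1, by simp⟩
  have hlog : ∀ c ∈ (range γ)ᶜ, ∃ l : C(ℝ, ℂ), (∀ t, Complex.exp (l t) = γ t - c) ∧
      ∃ k : ℤ, l (2 * Real.pi) - l 0 = k * (2 * Real.pi * Complex.I) := by
    intro c hc
    obtain ⟨l, hl⟩ := exists_continuousMap_exp_eq
      (⟨fun t ↦ γ t - c, by fun_prop⟩ : C(ℝ, ℂ))
      (fun t ↦ sub_ne_zero.2 fun h ↦ hc ⟨t, h⟩)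
    refine ⟨l, hl, Complex.exp_eq_one_iff.1 ?_⟩
    rw [Complex.exp_sub, hl, hl]
    simp only [ContinuousMap.coe_mk, hend]
    exact div_self (sub_ne_zero.2 fun h ↦ hc ⟨0, h⟩)
  obtain ⟨la, hla, ka, hka⟩ := hlog a ha
  obtain ⟨lb, hlb, kb, hkb⟩ := hlog b hb
  obtain ⟨n, m, hnm, hk⟩ : ∃ n m : ℤ, (n ≠ 0 ∨ m ≠ 0) ∧ n * ka = m * kb := by
    by_cases h : ka = 0
    · exact ⟨1, 0, by simp, by simp [h]⟩
    · exact ⟨kb, ka, Or.inr h, mul_comm _ _⟩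
  have hk' : (n : ℂ) * ka = m * kb := by exact_mod_cast hk
  have h02 : n * la 0 - m * lb 0 = n * la (2 * Real.pi) - m * lb (2 * Real.pi) := by
    linear_combination (2 * Real.pi * Complex.I) * (-hk') - n * hka + m * hkb
  obtain ⟨L, hL⟩ := exists_continuousMap_comp_eqOn_Icc (a := 0) (b := 2 * Real.pi) hγ
    (l := fun t ↦ n * la t - m * lb t) (by fun_prop) (by
      intro s hs t ht hst
      obtain ⟨k, hk⟩ := (hper s t).1 hst
      by_cases hlt : |s - t| < 2 * Real.pi
      · rw [eq_of_eq_add_int_mul_two_pi hlt hk]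
      · rw [not_lt, le_abs] at hlt
        rcases hlt with h | h
        · obtain rfl : t = 0 := by linarith [hs.1, hs.2, ht.1, ht.2]
          obtain rfl : s = 2 * Real.pi := by linarith [hs.1, hs.2, ht.1, ht.2]
          exact h02.symm
        · obtain rfl : s = 0 := by linarith [hs.1, hs.2, ht.1, ht.2]
          obtain rfl : t = 2 * Real.pi := by linarith [hs.1, hs.2, ht.1, ht.2]
          exact h02)
  refine ⟨n, m, L, hnm, ?_⟩
  rintro _ ⟨s, rfl⟩
  set s' := toIcoMod Real.two_pi_pos 0 s with hs'
  have hs'mem : s' ∈ Ico 0 (0 + 2 * Real.pi) := toIcoMod_mem_Ico Real.two_pi_pos 0 s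
  have hss' : γ s = γ s' := by
    refine (hper _ _).2 ⟨toIcoDiv Real.two_pi_pos 0 s, ?_⟩
    have := toIcoMod_add_toIcoDiv_zsmul Real.two_pi_pos 0 s
    rw [zsmul_eq_mul] at this
    exact this.symm
  rw [hss', hL s' ⟨hs'mem.1, by linarith [hs'mem.2]⟩]
  have h1 := hla s'
  have h2 := hlb s'
  rw [← h1, ← h2, ← Complex.exp_int_mul, ← Complex.exp_int_mul, ← Complex.exp_add]
  ring_nf

/-- The complement of a Jordan curve has at most one bounded component. -/
lemma IsJordanCurve.not_isBounded_of_notMem {C : Set ℂ} (hC : IsJordanCurve C) {a b : ℂ}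
    (ha : a ∈ Cᶜ) (hb : b ∈ Cᶜ) (hbb : Bornology.IsBounded (connectedComponentIn Cᶜ b))
    (hab : a ∉ connectedComponentIn Cᶜ b) :
    ¬ Bornology.IsBounded (connectedComponentIn Cᶜ a) := by
  intro hba
  have hCc := hC.isCompact.isClosed
  have hnot : ∀ c ∈ Cᶜ, ∀ d, d ∉ connectedComponentIn Cᶜ c → d ∈ Cᶜ →
      d ∉ closure (connectedComponentIn Cᶜ c) := by
    intro c hc d hd hdC hd'
    refine frontier_connectedComponentIn_subset hCc c ?_ |> hdC
    rw [(hCc.isOpen_compl.connectedComponentIn).frontier_eq]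
    exact ⟨hd', hd⟩
  have hba' : b ∉ connectedComponentIn Cᶜ a := fun h ↦ hab <| by
    rw [← connectedComponentIn_eq h]
    exact mem_connectedComponentIn ha
  have hcont : ∀ c ∈ Cᶜ, ∀ d ∈ Cᶜ, d ∉ connectedComponentIn Cᶜ c → ∀ k : ℤ,
      ContinuousOn (fun z ↦ (z - d) ^ k) (closure (connectedComponentIn Cᶜ c)) :=
    fun c hc d hd hdc k ↦ ContinuousOn.zpow₀ (by fun_prop) k fun z hz ↦ Or.inl <|
      sub_ne_zero.2 fun h ↦ hnot c hc d hdc hd (h ▸ hz)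
  obtain ⟨n, m, L, hnm, hL⟩ := hC.exists_zpow_eq ha hb
  have hn : n = 0 := eq_zero_of_zpow_eq_exp_mul hCc ha hba L (hcont a ha b hb hba' m)
    (fun z hz ↦ zpow_ne_zero _ (sub_ne_zero.2 fun h ↦ hba' (h ▸ hz))) hL
  have hm : m = 0 := eq_zero_of_zpow_eq_exp_mul hCc hb hbb (-L) (hcont b hb a ha hab n)
    (fun z hz ↦ zpow_ne_zero _ (sub_ne_zero.2 fun h ↦ hab (h ▸ hz))) (fun z hz ↦ by
      rw [hL z hz, ← mul_assoc, ← Complex.exp_add]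
      simp)
  exact hnm.elim (· hn) (· hm)

/-- The complement of the closure of a Jordan domain is connected, and its closure contains the
boundary of the domain. -/
lemma IsJordanDomain.topology {D : Set ℂ} (hD : IsJordanDomain D) :
    IsOpen D ∧ Bornology.IsBounded D ∧ IsPreconnected (closure D)ᶜ ∧
      frontier D ⊆ closure (closure D)ᶜ := by
  obtain ⟨C, hC, hb, z, hz, rfl⟩ := hD
  have hCc := hC.isCompact.isClosed
  have hDo : IsOpen (connectedComponentIn Cᶜ z) := hCc.isOpen_compl.connectedComponentIn
  obtain ⟨w, hw⟩ : ∃ w, w ∉ C ∪ connectedComponentIn Cᶜ z := by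
    by_contra! h
    exact NormedSpace.unbounded_univ ℂ ℂ
      ((hC.isCompact.isBounded.union hb).subset fun x _ ↦ h x)
  rw [mem_union, not_or] at hw
  have hCsub := hC.subset_closure hz hw.1 hw.2
  have hEq : (closure (connectedComponentIn Cᶜ z))ᶜ = connectedComponentIn Cᶜ w := by
    ext x
    constructor
    · intro hx
      have hxC : x ∈ Cᶜ := fun h ↦ hx (hCsub h)
      have hxD : x ∉ connectedComponentIn Cᶜ z := fun h ↦ hx (subset_closure h)
      rw [connectedComponentIn_eq_of_not_isBounded hC.isCompact.isBounded
        (hC.not_isBounded_of_notMem hw.1 hz hb hw.2) (hC.not_isBounded_of_notMem hxC hz hb hxD)]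
      exact mem_connectedComponentIn hxC
    · intro hx hx'
      have hxC : x ∈ Cᶜ := connectedComponentIn_subset _ _ hx
      by_cases hxD : x ∈ connectedComponentIn Cᶜ z
      · refine hw.2 ?_
        rw [connectedComponentIn_eq hxD, ← connectedComponentIn_eq hx]
        exact mem_connectedComponentIn hw.1
      · refine hxC (frontier_connectedComponentIn_subset hCc z ?_)
        rw [hDo.frontier_eq]
        exact ⟨hx', hxD⟩
  refine ⟨hDo, hb, ?_, ?_⟩
  · rw [hEq]
    exact isPreconnected_connectedComponentIn
  · rw [hEq]
    refine (frontier_connectedComponentIn_subset hCc z).trans (hC.subset_closure hw.1 hz ?_)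
    intro h
    refine hw.2 ?_
    rw [← connectedComponentIn_eq h]
    exact mem_connectedComponentIn hw.1

/-! ### Unions of disjoint compact sets -/

lemma HasLogAt.of_continuousOn {K : Set ℂ} (hK : IsClosed K) {a : ℂ} {l : ℂ → ℂ}
    (hl : ContinuousOn l K) (h : ∀ z ∈ K, Complex.exp (l z) = z - a) : HasLogAt K a := by
  obtain ⟨L, hL⟩ := ContinuousMap.exists_restrict_eq hK
    (⟨K.domRestrict l, hl.domRestrict⟩ : C(K, ℂ))
  refine ⟨L, fun z hz ↦ ?_⟩
  have : L z = l z := congrArg (fun φ : C(K, ℂ) ↦ φ ⟨z, hz⟩) hL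
  rw [this, h z hz]

lemma exp_log_one_add_and_continuousOn {K : Set ℂ} {v : ℂ → ℂ} (hv : ContinuousOn v K)
    (h : ∀ z ∈ K, ‖v z‖ < 1) : ContinuousOn (fun z ↦ Complex.log (1 + v z)) K ∧
      ∀ z ∈ K, Complex.exp (Complex.log (1 + v z)) = 1 + v z := by
  have hs : ∀ z ∈ K, 1 + v z ∈ Complex.slitPlane := fun z hz ↦
    Complex.mem_slitPlane_of_norm_lt_one (h z hz)
  exact ⟨(continuousOn_const.add hv).clog hs,
    fun z hz ↦ Complex.exp_log (Complex.slitPlane_ne_zero (hs z hz))⟩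

lemma HasLogAt.of_norm_lt {K : Set ℂ} (hK : IsClosed K) {a b : ℂ} (ha : HasLogAt K a)
    (hab : ∀ z ∈ K, ‖a - b‖ < ‖z - a‖) : HasLogAt K b := by
  obtain ⟨L, hL⟩ := ha
  have hne : ∀ z ∈ K, z - a ≠ 0 := fun z hz ↦
    norm_pos_iff.1 ((norm_nonneg _).trans_lt (hab z hz))
  obtain ⟨hc, he⟩ := exp_log_one_add_and_continuousOn (K := K) (v := fun z ↦ (a - b) / (z - a))
    (ContinuousOn.div (by fun_prop) (by fun_prop) hne)
    (fun z hz ↦ by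
      rw [norm_div, div_lt_one (norm_pos_iff.2 (hne z hz))]
      exact hab z hz)
  refine HasLogAt.of_continuousOn hK (L.continuous.continuousOn.add hc) fun z hz ↦ ?_
  rw [Pi.add_apply, Complex.exp_add, hL z hz, he z hz]
  field_simp [hne z hz]
  ring

lemma HasLogAt.of_norm_gt {K : Set ℂ} (hK : IsClosed K) {a : ℂ} (hab : ∀ z ∈ K, ‖z‖ < ‖a‖) :
    HasLogAt K a := by
  rcases eq_or_ne a 0 with rfl | ha
  · exact ⟨0, fun z hz ↦ absurd (hab z hz) (by simp)⟩
  obtain ⟨hc, he⟩ := exp_log_one_add_and_continuousOn (K := K) (v := fun z ↦ -(z / a))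
    (by fun_prop) (fun z hz ↦ by
      rw [norm_neg, norm_div, div_lt_one (norm_pos_iff.2 ha)]
      exact hab z hz)
  refine HasLogAt.of_continuousOn hK
    ((continuousOn_const (c := Complex.log (-a))).add hc) fun z hz ↦ ?_
  rw [Pi.add_apply, Complex.exp_add, he z hz, Complex.exp_log (neg_ne_zero.2 ha)]
  field_simp
  ring

/-- If the complement of a compact set `K` is connected, every `z - a` with `a ∉ K` has a
continuous logarithm on `K`. -/
lemma IsCompact.hasLogAt {K : Set ℂ} (hK : IsCompact K) (hc : IsPreconnected Kᶜ) {a : ℂ}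
    (ha : a ∈ Kᶜ) : HasLogAt K a := by
  rcases K.eq_empty_or_nonempty with rfl | hne
  · exact ⟨0, by simp⟩
  have hpos : ∀ b ∈ Kᶜ, 0 < infDist b K := fun b hb ↦
    (hK.isClosed.notMem_iff_infDist_pos hne).1 hb
  have hle : ∀ b, ∀ z ∈ K, infDist b K ≤ ‖z - b‖ := fun b z hz ↦ by
    rw [← dist_eq_norm, dist_comm]
    exact infDist_le_dist_of_mem hz
  have hopen : IsOpen {b | b ∈ Kᶜ ∧ HasLogAt K b} := by
    rw [Metric.isOpen_iff]
    rintro b ⟨hb, hlog⟩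
    refine ⟨infDist b K, hpos b hb, fun c hcb ↦ ?_⟩
    rw [mem_ball, dist_comm, dist_eq_norm] at hcb
    refine ⟨fun hcK ↦ ?_, hlog.of_norm_lt hK.isClosed fun z hz ↦ hcb.trans_le (hle b z hz)⟩
    have := hle b c hcK
    rw [norm_sub_rev] at this
    linarith
  obtain ⟨R, hR, hKR⟩ := exists_pos_subset_closedBall hK.isBounded
  have hlarge : ((R + 1 : ℝ) : ℂ) ∈ Kᶜ ∩ {b | b ∈ Kᶜ ∧ HasLogAt K b} := by
    have hn : ‖((R + 1 : ℝ) : ℂ)‖ = R + 1 := by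
      rw [Complex.norm_real, Real.norm_of_nonneg (by linarith)]
    have hm : ((R + 1 : ℝ) : ℂ) ∈ Kᶜ := fun h ↦ by
      have := mem_closedBall_zero_iff.1 (hKR h)
      linarith
    refine ⟨hm, hm, HasLogAt.of_norm_gt hK.isClosed fun z hz ↦ ?_⟩
    have := mem_closedBall_zero_iff.1 (hKR hz)
    linarith
  refine (hc.subset_of_closure_inter_subset hopen ⟨_, hlarge⟩ ?_ ha).2
  rintro b ⟨hbcl, hb⟩
  obtain ⟨c, ⟨hcK, hclog⟩, hcb⟩ := Metric.mem_closure_iff.1 hbcl (infDist b K / 2) (half_pos (hpos b hb))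
  refine ⟨hb, hclog.of_norm_lt hK.isClosed fun z hz ↦ ?_⟩
  rw [dist_comm, dist_eq_norm] at hcb
  have h1 := hle b z hz
  have h2 : ‖z - b‖ ≤ ‖z - c‖ + ‖c - b‖ := by simpa using norm_sub_le_norm_sub_add_norm_sub z c b
  linarith

lemma isPreconnected_compl_iUnion {ι : Type*} [Finite ι] {K : ι → Set ℂ}
    (hK : ∀ i, IsCompact (K i)) (hc : ∀ i, IsPreconnected (K i)ᶜ)
    (hd : ∀ i j, i ≠ j → Disjoint (K i) (K j)) : IsPreconnected (⋃ i, K i)ᶜ := by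
  classical
  have hU : IsCompact (⋃ i, K i) := isCompact_iUnion hK
  refine isPreconnected_compl_of_forall_not_isBounded hU.isBounded fun a ha ↦
    HasLogAt.not_isBounded hU.isClosed ha ?_
  have hlog : ∀ i, HasLogAt (K i) a := fun i ↦
    (hK i).hasLogAt (hc i) fun h ↦ ha (mem_iUnion_of_mem i h)
  choose L hL using hlog
  let l : ℂ → ℂ := fun z ↦ if h : ∃ i, z ∈ K i then L h.choose z else 0
  have hl : ∀ i, ∀ z ∈ K i, l z = L i z := by
    intro i z hz
    have h : ∃ i, z ∈ K i := ⟨i, hz⟩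
    have : h.choose = i := by
      by_contra hne
      exact disjoint_left.1 (hd _ _ hne) h.choose_spec hz
    simp only [l, dif_pos h, this]
  refine HasLogAt.of_continuousOn hU.isClosed (l := l) ?_ ?_
  · exact (locallyFinite_of_finite K).continuousOn_iUnion (fun i ↦ (hK i).isClosed)
      fun i ↦ (L i).continuous.continuousOn.congr (hl i)
  · intro z hz
    obtain ⟨i, hi⟩ := mem_iUnion.1 hz
    rw [hl i z hi, hL i z hi]

lemma IsArchipelago.topology {N : ℕ} {Gs : Fin N → Set ℂ} (h : IsArchipelago Gs) :
    IsOpen (⋃ j, Gs j) ∧ Bornology.IsBounded (⋃ j, Gs j) ∧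
      IsPreconnected (closure (⋃ j, Gs j))ᶜ ∧
      frontier (⋃ j, Gs j) ⊆ closure (closure (⋃ j, Gs j))ᶜ := by
  have hcl : closure (⋃ j, Gs j) = ⋃ j, closure (Gs j) := closure_iUnion_of_finite _
  refine ⟨isOpen_iUnion fun j ↦ (h.1 j).topology.1,
    Bornology.isBounded_iUnion.2 fun j ↦ (h.1 j).topology.2.1, ?_, ?_⟩
  · rw [hcl]
    exact isPreconnected_compl_iUnion (fun j ↦ (h.1 j).topology.2.1.isCompact_closure)
      (fun j ↦ (h.1 j).topology.2.2.1) h.2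
  · intro z hz
    obtain ⟨j, hj⟩ := mem_iUnion.1 (hcl ▸ frontier_subset_closure hz)
    have hopen : IsOpen (⋃ j, Gs j) := isOpen_iUnion fun j ↦ (h.1 j).topology.1
    have hzj : z ∈ frontier (Gs j) := by
      rw [(h.1 j).topology.1.frontier_eq]
      rw [hopen.frontier_eq] at hz
      exact ⟨hj, fun h' ↦ hz.2 (mem_iUnion_of_mem j h')⟩
    have hO : IsOpen (⋂ k : {k // k ≠ j}, (closure (Gs k))ᶜ) :=
      isOpen_iInter_of_finite fun k ↦ isClosed_closure.isOpen_compl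
    have hzO : z ∈ ⋂ k : {k // k ≠ j}, (closure (Gs k))ᶜ :=
      mem_iInter.2 fun k ↦ disjoint_left.1 (h.2 j k k.2.symm) hj
    rw [_root_.mem_closure_iff]
    intro V hV hzV
    obtain ⟨w, ⟨hwV, hwO⟩, hwj⟩ := _root_.mem_closure_iff.1 ((h.1 j).topology.2.2.2 hzj) _
      (hV.inter hO) ⟨hzV, hzO⟩
    refine ⟨w, hwV, ?_⟩
    rw [hcl, mem_compl_iff, mem_iUnion, not_exists]
    intro k
    by_cases hk : k = j
    · exact hk ▸ hwj
    · exact mem_iInter.1 hwO ⟨k, hk⟩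

/-! ### The operator `∂/∂x + i ∂/∂y` -/

/-- The Cauchy-Riemann operator `∂/∂x + i ∂/∂y`. -/
def dbar (u : ℂ → ℂ) (z : ℂ) : ℂ := fderiv ℝ u z 1 + Complex.I * fderiv ℝ u z Complex.I

lemma dbar_mul {u v : ℂ → ℂ} {z : ℂ} (hu : DifferentiableAt ℝ u z) (hv : DifferentiableAt ℝ v z) :
    dbar (fun w ↦ u w * v w) z = dbar u z * v z + u z * dbar v z := by
  simp only [dbar, fderiv_fun_mul hu hv, add_apply,
    smul_apply, smul_eq_mul]
  ring

lemma dbar_eq_zero_iff {u : ℂ → ℂ} {z : ℂ} (hu : DifferentiableAt ℝ u z) :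
    dbar u z = 0 ↔ DifferentiableAt ℂ u z := by
  rw [differentiableAt_complex_iff_differentiableAt_real, and_iff_right hu, dbar, smul_eq_mul]
  constructor
  · intro h
    linear_combination (-Complex.I) * h + fderiv ℝ u z Complex.I * Complex.I_mul_I
  · intro h
    rw [h]
    linear_combination fderiv ℝ u z 1 * Complex.I_mul_I

lemma norm_dbar_le (u : ℂ → ℂ) (z : ℂ) : ‖dbar u z‖ ≤ 2 * ‖fderiv ℝ u z‖ := by
  have h1 := (fderiv ℝ u z).le_opNorm 1
  have h2 := (fderiv ℝ u z).le_opNorm Complex.I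
  rw [norm_one, mul_one] at h1
  rw [Complex.norm_I, mul_one] at h2
  have h3 : ‖Complex.I * fderiv ℝ u z Complex.I‖ = ‖fderiv ℝ u z Complex.I‖ := by
    rw [norm_mul, Complex.norm_I, one_mul]
  have := norm_add_le (fderiv ℝ u z 1) (Complex.I * fderiv ℝ u z Complex.I)
  rw [dbar]
  linarith

lemma dbar_congr {u v : ℂ → ℂ} {z : ℂ} (h : u =ᶠ[nhds z] v) : dbar u z = dbar v z := by
  rw [dbar, dbar, h.fderiv_eq]

lemma continuous_dbar {u : ℂ → ℂ} (hu : ContDiff ℝ 1 u) : Continuous (dbar u) := by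
  have := hu.continuous_fderiv one_ne_zero
  unfold dbar
  fun_prop

lemma HasCompactSupport.dbar {u : ℂ → ℂ} (hu : HasCompactSupport u) :
    HasCompactSupport (dbar u) := by
  refine (hu.fderiv ℝ).mono fun z hz ↦ ?_
  contrapose! hz
  rw [Function.mem_support, not_not] at hz ⊢
  simp [_root_.dbar, hz]

lemma integral_fderiv_apply_eq_zero {h : ℂ → ℂ} (hd : ContDiff ℝ 1 h) (hc : HasCompactSupport h)
    (v : ℂ) : ∫ z, fderiv ℝ h z v = 0 := by
  have hcont := hd.continuous_fderiv one_ne_zero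
  have hi : Integrable (fun z ↦ fderiv ℝ h z v) :=
    Continuous.integrable_of_hasCompactSupport (by fun_prop) (hc.fderiv_apply ℝ v)
  have := integral_mul_fderiv_eq_neg_fderiv_mul_of_integrable (μ := volume) (f := fun _ : ℂ ↦ (1 : ℂ))
    (g := h) (v := v) (by simp) (by simpa using hi)
    (by simpa using hd.continuous.integrable_of_hasCompactSupport hc)
    (by simp) (fun x _ ↦ (hd.differentiable one_ne_zero) x)
  simpa using this

lemma integral_dbar_eq_zero {h : ℂ → ℂ} (hd : ContDiff ℝ 1 h) (hc : HasCompactSupport h) :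
    ∫ z, dbar h z = 0 := by
  have hcont := hd.continuous_fderiv one_ne_zero
  have hi : ∀ v, Integrable (fun z ↦ fderiv ℝ h z v) := fun v ↦
    Continuous.integrable_of_hasCompactSupport (by fun_prop) (hc.fderiv_apply ℝ v)
  unfold dbar
  rw [integral_add (hi 1) ((hi _).const_mul _), integral_const_mul,
    integral_fderiv_apply_eq_zero hd hc, integral_fderiv_apply_eq_zero hd hc]
  simp

lemma integral_conj_fderiv_mul_fderiv {u : ℂ → ℂ} (hd : ContDiff ℝ 2 u)
    (hc : HasCompactSupport u) (v w : ℂ) :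
    ∫ z, (starRingEnd ℂ) (fderiv ℝ u z v) * fderiv ℝ u z w =
      -∫ z, (starRingEnd ℂ) (fderiv ℝ (fderiv ℝ u) z w v) * u z := by
  have hd1 : ContDiff ℝ 1 (fderiv ℝ u) := hd.fderiv_right (by norm_num)
  have hc1 := hd1.continuous
  have hc2 := hd1.continuous_fderiv one_ne_zero
  have hcu := hd.continuous
  have hF : ∀ z, fderiv ℝ (fun z ↦ (starRingEnd ℂ) (fderiv ℝ u z v)) z w =
      (starRingEnd ℂ) (fderiv ℝ (fderiv ℝ u) z w v) := by
    intro z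
    have h1 : HasFDerivAt (fun z ↦ fderiv ℝ u z v)
        ((fderiv ℝ (fderiv ℝ u) z).flip v) z :=
      ((ContinuousLinearMap.apply ℝ ℂ v).hasFDerivAt.comp z
        ((hd1.differentiable one_ne_zero) z).hasFDerivAt)
    have h2 := (Complex.conjCLE.toContinuousLinearMap.hasFDerivAt).comp z h1
    have h3 : HasFDerivAt (fun z ↦ (starRingEnd ℂ) (fderiv ℝ u z v)) _ z := h2
    rw [h3.fderiv]
    rfl
  have := integral_mul_fderiv_eq_neg_fderiv_mul_of_integrable (μ := volume)
    (f := fun z ↦ (starRingEnd ℂ) (fderiv ℝ u z v)) (g := u) (v := w) ?_ ?_ ?_ ?_ ?_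
  · simp_rw [hF] at this
    exact this
  · simp_rw [hF]
    exact Continuous.integrable_of_hasCompactSupport (by fun_prop) hc.mul_left
  · exact Continuous.integrable_of_hasCompactSupport (by fun_prop) (hc.fderiv_apply ℝ w).mul_left
  · exact Continuous.integrable_of_hasCompactSupport (by fun_prop) hc.mul_left
  · intro z _
    exact Complex.conjCLE.toContinuousLinearMap.differentiableAt.comp z
      (((hd1.differentiable one_ne_zero) z).clm_apply (differentiableAt_const v))
  · exact fun z _ ↦ (hd.differentiable two_ne_zero) z

/-- The two partial derivatives of a compactly supported function have the same energy as its
Cauchy-Riemann derivative. -/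
lemma integral_normSq_dbar {u : ℂ → ℂ} (hd : ContDiff ℝ 2 u) (hc : HasCompactSupport u) :
    ∫ z, Complex.normSq (dbar u z) =
      ∫ z, (Complex.normSq (fderiv ℝ u z 1) + Complex.normSq (fderiv ℝ u z Complex.I)) := by
  have hc1 := hd.continuous_fderiv two_ne_zero
  have hi : ∀ v w : ℂ, Integrable fun z ↦ (starRingEnd ℂ) (fderiv ℝ u z v) * fderiv ℝ u z w :=
    fun v w ↦ Continuous.integrable_of_hasCompactSupport (by fun_prop)
      (hc.fderiv_apply ℝ w).mul_left
  have hn : ∀ v : ℂ, Integrable fun z ↦ Complex.normSq (fderiv ℝ u z v) := fun v ↦ by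
    refine (hi v v).re.congr (ae_of_all _ fun z ↦ ?_)
    simp [Complex.normSq_apply]
  have hsymm : ∫ z, (starRingEnd ℂ) (fderiv ℝ u z 1) * fderiv ℝ u z Complex.I =
      ∫ z, (starRingEnd ℂ) (fderiv ℝ u z Complex.I) * fderiv ℝ u z 1 := by
    rw [integral_conj_fderiv_mul_fderiv hd hc, integral_conj_fderiv_mul_fderiv hd hc]
    congr 2
    ext z
    rw [(hd.contDiffAt (x := z)).isSymmSndFDerivAt (by simp) 1 Complex.I]
  have hcross : ∫ z, ((starRingEnd ℂ) (fderiv ℝ u z Complex.I) * fderiv ℝ u z 1).im = 0 := by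
    have h1 : ∫ z, ((starRingEnd ℂ) (fderiv ℝ u z 1) * fderiv ℝ u z Complex.I).im =
        ∫ z, ((starRingEnd ℂ) (fderiv ℝ u z Complex.I) * fderiv ℝ u z 1).im := by
      have e1 := integral_im (hi 1 Complex.I)
      have e2 := integral_im (hi Complex.I 1)
      simp only [RCLike.im_to_complex] at e1 e2
      rw [e1, e2, hsymm]
    have h2 : ∫ z, ((starRingEnd ℂ) (fderiv ℝ u z 1) * fderiv ℝ u z Complex.I).im =
        -∫ z, ((starRingEnd ℂ) (fderiv ℝ u z Complex.I) * fderiv ℝ u z 1).im := by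
      rw [← integral_neg]
      congr 1
      ext z
      simp
      ring
    linarith
  have hexp : ∀ z, Complex.normSq (dbar u z) =
      Complex.normSq (fderiv ℝ u z 1) + Complex.normSq (fderiv ℝ u z Complex.I) +
        2 * ((starRingEnd ℂ) (fderiv ℝ u z Complex.I) * fderiv ℝ u z 1).im := by
    intro z
    simp [dbar, Complex.normSq_apply]
    ring
  simp_rw [hexp]
  refine (integral_add ((hn 1).add (hn Complex.I)) ((hi Complex.I 1).im.const_mul 2)).trans ?_
  rw [integral_const_mul]
  simp only [RCLike.im_to_complex, hcross, mul_zero, add_zero, Pi.add_apply]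

lemma norm_sq_le_normSq_add_normSq (T : ℂ →L[ℝ] ℂ) :
    ‖T‖ ^ 2 ≤ Complex.normSq (T 1) + Complex.normSq (T Complex.I) := by
  have hnn : 0 ≤ Complex.normSq (T 1) + Complex.normSq (T Complex.I) :=
    add_nonneg (Complex.normSq_nonneg _) (Complex.normSq_nonneg _)
  refine (Real.le_sqrt (norm_nonneg _) hnn).1 ?_
  refine T.opNorm_le_bound (Real.sqrt_nonneg _) fun z ↦ ?_
  refine abs_le_of_sq_le_sq' ?_ (by positivity) |>.2
  rw [mul_pow, Real.sq_sqrt hnn, Complex.sq_norm, Complex.sq_norm]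
  have hz : T z = z.re * T 1 + z.im * T Complex.I := by
    conv_lhs => rw [show z = z.re • (1 : ℂ) + z.im • Complex.I by simp]
    rw [map_add, map_smul, map_smul]
    simp
  rw [hz]
  simp only [Complex.normSq_apply, Complex.add_re, Complex.add_im, Complex.re_ofReal_mul,
    Complex.im_ofReal_mul]
  nlinarith [sq_nonneg (z.re * (T Complex.I).re - z.im * (T 1).re),
    sq_nonneg (z.re * (T Complex.I).im - z.im * (T 1).im)]

lemma lintegral_enorm_fderiv_sq_le {u : ℂ → ℂ} (hd : ContDiff ℝ 2 u) (hc : HasCompactSupport u) :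
    ∫⁻ z, ‖fderiv ℝ u z‖ₑ ^ 2 ≤ ∫⁻ z, ‖dbar u z‖ₑ ^ 2 := by
  have hc1 := hd.continuous_fderiv two_ne_zero
  have hd1 : ContDiff ℝ 1 u := hd.of_le (by norm_num)
  have key : ∀ {E : Type} [NormedAddCommGroup E] (x : E), ‖x‖ₑ ^ 2 = ENNReal.ofReal (‖x‖ ^ 2) :=
    fun x ↦ by rw [ENNReal.ofReal_pow (norm_nonneg _), ofReal_norm]
  simp_rw [key]
  have hcd := continuous_dbar hd1
  have hfc : HasCompactSupport (fderiv ℝ u) := hc.fderiv ℝ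
  rw [← ofReal_integral_eq_lintegral_ofReal, ← ofReal_integral_eq_lintegral_ofReal]
  · apply ENNReal.ofReal_le_ofReal
    simp_rw [Complex.sq_norm, integral_normSq_dbar hd hc]
    refine integral_mono_of_nonneg (ae_of_all _ fun z ↦ by positivity) ?_
      (ae_of_all _ fun z ↦ norm_sq_le_normSq_add_normSq _)
    refine Continuous.integrable_of_hasCompactSupport (by fun_prop) (hfc.mono fun z hz ↦ ?_)
    contrapose! hz
    rw [Function.mem_support, not_not] at hz ⊢
    simp [hz]
  · refine Continuous.integrable_of_hasCompactSupport (by fun_prop) (hc.dbar.mono fun z hz ↦ ?_)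
    contrapose! hz
    rw [Function.mem_support, not_not] at hz ⊢
    simp [hz]
  · exact ae_of_all _ fun z ↦ by positivity
  · refine Continuous.integrable_of_hasCompactSupport (by fun_prop) (hfc.mono fun z hz ↦ ?_)
    contrapose! hz
    rw [Function.mem_support, not_not] at hz ⊢
    simp [hz]
  · exact ae_of_all _ fun z ↦ by positivity

/-! ### The Cauchy transform -/

/-- The point of the unit circle with argument `θ`. -/
def circlePt (θ : ℝ) : ℂ := Real.cos θ + Real.sin θ * Complex.I

lemma continuous_circlePt : Continuous circlePt := by
  unfold circlePt
  fun_prop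

lemma norm_circlePt (θ : ℝ) : ‖circlePt θ‖ = 1 := by
  simp [circlePt, Complex.norm_cos_add_sin_mul_I]

lemma hasDerivAt_circlePt (θ : ℝ) : HasDerivAt circlePt (Complex.I * circlePt θ) θ := by
  have h := (Real.hasDerivAt_cos θ).ofReal_comp.add
    ((Real.hasDerivAt_sin θ).ofReal_comp.mul_const Complex.I)
  refine h.congr_deriv ?_
  rw [circlePt, Complex.ofReal_neg]
  linear_combination (-(Real.sin θ : ℂ)) * Complex.I_mul_I

lemma circlePt_pi : circlePt Real.pi = circlePt (-Real.pi) := by simp [circlePt]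

lemma polarCoord_symm_eq (p : ℝ × ℝ) : Complex.polarCoord.symm p = p.1 * circlePt p.2 := by
  rw [Complex.polarCoord_symm_apply, circlePt]

lemma dbar_mul_circlePt_inv (ψ : ℂ → ℂ) (z : ℂ) (θ : ℝ) :
    dbar ψ z * (circlePt θ)⁻¹ = fderiv ℝ ψ z (circlePt θ) +
      Complex.I * fderiv ℝ ψ z (Complex.I * circlePt θ) := by
  have hinv : (circlePt θ)⁻¹ = Real.cos θ - Real.sin θ * Complex.I := by
    refine inv_eq_of_mul_eq_one_left ?_
    have := Real.sin_sq_add_cos_sq θ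
    have h' : ((Real.sin θ : ℂ)) ^ 2 + (Real.cos θ : ℂ) ^ 2 = 1 := by exact_mod_cast this
    rw [circlePt]
    linear_combination h' - (Real.sin θ : ℂ) ^ 2 * Complex.I_mul_I
  have h1 : fderiv ℝ ψ z (circlePt θ) =
      Real.cos θ * fderiv ℝ ψ z 1 + Real.sin θ * fderiv ℝ ψ z Complex.I := by
    rw [circlePt, show (Real.cos θ : ℂ) + Real.sin θ * Complex.I =
      Real.cos θ • (1 : ℂ) + Real.sin θ • Complex.I by simp, map_add, map_smul, map_smul]
    simp
  have h2 : fderiv ℝ ψ z (Complex.I * circlePt θ) =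
      Real.cos θ * fderiv ℝ ψ z Complex.I - Real.sin θ * fderiv ℝ ψ z 1 := by
    rw [circlePt, show Complex.I * ((Real.cos θ : ℂ) + Real.sin θ * Complex.I) =
      Real.cos θ • Complex.I - Real.sin θ • (1 : ℂ) by
        simp only [Complex.real_smul]
        linear_combination (Real.sin θ : ℂ) * Complex.I_mul_I, map_sub, map_smul, map_smul]
    simp
  rw [hinv, h1, h2, dbar]
  linear_combination (- Real.sin θ * fderiv ℝ ψ z Complex.I) * Complex.I_mul_I

lemma hasDerivAt_comp_radius {ψ : ℂ → ℂ} (hψ : Differentiable ℝ ψ) (c : ℂ) (r θ : ℝ) :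
    HasDerivAt (fun r : ℝ ↦ ψ (c + r * circlePt θ))
      (fderiv ℝ ψ (c + r * circlePt θ) (circlePt θ)) r := by
  have h : HasDerivAt (fun r : ℝ ↦ c + (r : ℂ) * circlePt θ) (circlePt θ) r := by
    simpa using ((hasDerivAt_id r).ofReal_comp.mul_const (circlePt θ)).const_add c
  exact (hψ _).hasFDerivAt.comp_hasDerivAt r h

lemma hasDerivAt_comp_angle {ψ : ℂ → ℂ} (hψ : Differentiable ℝ ψ) (c : ℂ) (r θ : ℝ) :
    HasDerivAt (fun θ : ℝ ↦ ψ (c + r * circlePt θ))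
      (r * fderiv ℝ ψ (c + r * circlePt θ) (Complex.I * circlePt θ)) θ := by
  have h : HasDerivAt (fun θ : ℝ ↦ c + (r : ℂ) * circlePt θ) (r * (Complex.I * circlePt θ)) θ :=
    ((hasDerivAt_circlePt θ).const_mul (r : ℂ)).const_add c
  refine ((hψ _).hasFDerivAt.comp_hasDerivAt θ h).congr_deriv ?_
  rw [show (r : ℂ) * (Complex.I * circlePt θ) = r • (Complex.I * circlePt θ) by simp, map_smul]
  simp

/-- The Cauchy-Pompeiu formula for compactly supported functions. -/
lemma integral_dbar_mul_inv {ψ : ℂ → ℂ} (hψ : ContDiff ℝ 1 ψ) (hc : HasCompactSupport ψ) :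
    ∫ t, dbar ψ t * t⁻¹ = -(2 * Real.pi) * ψ 0 := by
  have hdiff := hψ.differentiable one_ne_zero
  have hcont := hψ.continuous_fderiv one_ne_zero
  have hcirc := continuous_circlePt
  obtain ⟨R, hR, hsub⟩ := exists_pos_subset_closedBall hc.isBounded
  have hzero : ∀ z : ℂ, R < ‖z‖ → z ∉ tsupport ψ := fun z hz h ↦ by
    have := mem_closedBall_zero_iff.1 (hsub h)
    linarith
  have hfz : ∀ z : ℂ, R < ‖z‖ → fderiv ℝ ψ z = 0 := fun z hz ↦ by
    by_contra h
    exact hzero z hz (support_fderiv_subset ℝ h)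
  have hnorm : ∀ r θ : ℝ, 0 ≤ r → ‖(r : ℂ) * circlePt θ‖ = r := fun r θ hr ↦ by
    rw [norm_mul, norm_circlePt, mul_one, Complex.norm_real, Real.norm_of_nonneg hr]
  let F : ℝ × ℝ → ℂ := fun p ↦ fderiv ℝ ψ (p.1 * circlePt p.2) (circlePt p.2)
  let H : ℝ × ℝ → ℂ := fun p ↦
    Complex.I * fderiv ℝ ψ (p.1 * circlePt p.2) (Complex.I * circlePt p.2)
  have hinteg : ∀ f : ℝ × ℝ → ℂ, Continuous f → (∀ r θ : ℝ, R < r → f (r, θ) = 0) →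
      Integrable f ((volume.restrict (Ioi (0 : ℝ))).prod
        (volume.restrict (Ioo (-Real.pi) Real.pi))) := by
    intro f hf h0
    rw [Measure.prod_restrict]
    have h1 : IntegrableOn f (Icc 0 R ×ˢ Icc (-Real.pi) Real.pi) (volume.prod volume) :=
      hf.continuousOn.integrableOn_compact (isCompact_Icc.prod isCompact_Icc)
    refine h1.of_forall_sdiff_eq_zero (measurableSet_Ioi.prod measurableSet_Ioo) ?_
    rintro ⟨r, θ⟩ ⟨⟨hr, hθ⟩, hn⟩
    refine h0 r θ (lt_of_not_ge fun hle ↦ hn ⟨⟨(mem_Ioi.1 hr).le, hle⟩, Ioo_subset_Icc_self hθ⟩)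
  have hF : Integrable F ((volume.restrict (Ioi (0 : ℝ))).prod
      (volume.restrict (Ioo (-Real.pi) Real.pi))) := by
    refine hinteg F (by fun_prop) fun r θ hr ↦ ?_
    simp only [F]
    rw [hfz _ (by rwa [hnorm r θ (by linarith)])]
    simp
  have hH : Integrable H ((volume.restrict (Ioi (0 : ℝ))).prod
      (volume.restrict (Ioo (-Real.pi) Real.pi))) := by
    refine hinteg H (by fun_prop) fun r θ hr ↦ ?_
    simp only [H]
    rw [hfz _ (by rwa [hnorm r θ (by linarith)])]
    simp
  have hpol : ∫ t, dbar ψ t * t⁻¹ = ∫ p, F p + H p ∂((volume.restrict (Ioi (0 : ℝ))).prod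
      (volume.restrict (Ioo (-Real.pi) Real.pi))) := by
    rw [← Complex.integral_comp_polarCoord_symm, Measure.prod_restrict, ← Measure.volume_eq_prod]
    refine setIntegral_congr_fun (measurableSet_Ioi.prod measurableSet_Ioo) ?_
    rintro ⟨r, θ⟩ ⟨hr, -⟩
    have hr' : (r : ℂ) ≠ 0 := Complex.ofReal_ne_zero.2 (ne_of_gt hr)
    simp only [F, H, polarCoord_symm_eq]
    rw [← dbar_mul_circlePt_inv, mul_inv, Complex.real_smul]
    field_simp
  have hFi : ∀ θ, ∫ r in Ioi (0 : ℝ), F (r, θ) = -ψ 0 := by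
    intro θ
    have hd : ContDiff ℝ 1 fun r : ℝ ↦ ψ (r * circlePt θ) :=
      hψ.comp (Complex.ofRealCLM.contDiff.mul contDiff_const)
    have hcs : HasCompactSupport fun r : ℝ ↦ ψ (r * circlePt θ) := by
      refine HasCompactSupport.intro (K := Icc (-R) R) isCompact_Icc fun r hr ↦ ?_
      refine image_eq_zero_of_notMem_tsupport (hzero _ ?_)
      rw [norm_mul, norm_circlePt, mul_one, Complex.norm_real, Real.norm_eq_abs]
      by_contra! h
      exact hr (abs_le.1 h)
    have := HasCompactSupport.integral_Ioi_deriv_eq hd hcs 0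
    simp only [Complex.ofReal_zero, zero_mul] at this
    rw [← this]
    refine integral_congr_ae (ae_of_all _ fun r ↦ ?_)
    have := (hasDerivAt_comp_radius hdiff 0 r θ).deriv
    simp only [zero_add] at this
    exact this.symm
  have hHi : ∀ r ∈ Ioi (0 : ℝ), ∫ θ in Ioo (-Real.pi) Real.pi, H (r, θ) = 0 := by
    intro r hr
    have hr' : (r : ℂ) ≠ 0 := Complex.ofReal_ne_zero.2 (ne_of_gt hr)
    rw [← integral_Ioc_eq_integral_Ioo,
      ← intervalIntegral.integral_of_le (by linarith [Real.pi_pos])]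
    simp only [H]
    rw [intervalIntegral.integral_const_mul]
    have h := intervalIntegral.integral_eq_sub_of_hasDerivAt (a := -Real.pi) (b := Real.pi)
      (fun θ _ ↦ hasDerivAt_comp_angle hdiff 0 r θ)
      (Continuous.intervalIntegrable (by fun_prop) _ _)
    simp only [zero_add] at h
    rw [circlePt_pi, sub_self, intervalIntegral.integral_const_mul] at h
    rw [(mul_eq_zero.1 h).resolve_left hr', mul_zero]
  rw [hpol, integral_add hF hH, integral_prod_symm F hF, integral_prod H hH]
  simp_rw [hFi]
  rw [setIntegral_congr_fun measurableSet_Ioi hHi]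
  rw [setIntegral_const, Real.volume_real_Ioo_of_le (by linarith [Real.pi_pos]), integral_zero,
    Complex.real_smul]
  push_cast
  ring

lemma locallyIntegrable_inv : LocallyIntegrable (fun t : ℂ ↦ t⁻¹) := by
  refine locallyIntegrable_of_norm_le_rpow (C := 1) (α := 1) (by simp) (by simp)
    (ae_of_all _ fun t ↦ ?_) measurable_inv.aestronglyMeasurable
  rw [norm_inv, Real.rpow_neg_one, one_mul]

/-- The Cauchy transform of `φ`, normalized so as to invert the operator `dbar`. -/
def cauchyTransform (φ : ℂ → ℂ) (w : ℂ) : ℂ := (2 * Real.pi : ℂ)⁻¹ * ∫ t, φ t * (w - t)⁻¹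

lemma cauchyTransform_eq_convolution (φ : ℂ → ℂ) : cauchyTransform φ = fun w ↦
    (2 * Real.pi : ℂ)⁻¹ *
      convolution φ (fun t ↦ t⁻¹) (ContinuousLinearMap.mul ℝ ℂ) volume w := by
  ext w
  simp [cauchyTransform, convolution]

lemma contDiff_cauchyTransform {φ : ℂ → ℂ} {n : ℕ∞} (hφ : ContDiff ℝ n φ)
    (hc : HasCompactSupport φ) : ContDiff ℝ n (cauchyTransform φ) := by
  rw [cauchyTransform_eq_convolution]
  exact contDiff_const.mul (hc.contDiff_convolution_left _ hφ locallyIntegrable_inv)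

lemma dbar_comp_const_sub {φ : ℂ → ℂ} (hφ : Differentiable ℝ φ) (w s : ℂ) :
    dbar (fun t ↦ φ (w - t)) s = -dbar φ (w - s) := by
  have h : HasFDerivAt (fun t ↦ φ (w - t)) ((fderiv ℝ φ (w - s)).comp
      (-ContinuousLinearMap.id ℝ ℂ)) s :=
    (hφ (w - s)).hasFDerivAt.comp s ((hasFDerivAt_id s).const_sub w)
  simp only [dbar, h.fderiv]
  simp
  ring

lemma dbar_cauchyTransform {φ : ℂ → ℂ} (hφ : ContDiff ℝ 1 φ) (hc : HasCompactSupport φ) :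
    dbar (cauchyTransform φ) = φ := by
  have hdiff := hφ.differentiable one_ne_zero
  have hcont := hφ.continuous_fderiv one_ne_zero
  ext w
  have hi : ∀ v, Integrable (fun t ↦ fderiv ℝ φ t v * (w - t)⁻¹) := fun v ↦ by
    have h1 : HasCompactSupport fun t ↦ fderiv ℝ φ t v := hc.fderiv_apply ℝ v
    have := h1.convolutionExists_left (ContinuousLinearMap.mul ℝ ℂ)
      (g := fun t : ℂ ↦ t⁻¹) (μ := volume) (by fun_prop) locallyIntegrable_inv w
    simpa [ConvolutionExistsAt] using this
  have hconv := hc.hasFDerivAt_convolution_left (ContinuousLinearMap.mul ℝ ℂ) hφ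
    locallyIntegrable_inv w
  have hex : Integrable (fun t ↦ (ContinuousLinearMap.mul ℝ ℂ).precompL ℂ (fderiv ℝ φ t)
      (w - t)⁻¹) :=
    (hc.fderiv ℝ).convolutionExists_left ((ContinuousLinearMap.mul ℝ ℂ).precompL ℂ) hcont
      locallyIntegrable_inv w
  have hval : ∀ v, fderiv ℝ (cauchyTransform φ) w v =
      (2 * Real.pi : ℂ)⁻¹ * ∫ t, fderiv ℝ φ t v * (w - t)⁻¹ := by
    intro v
    rw [cauchyTransform_eq_convolution, (hconv.const_mul _).fderiv, smul_apply, smul_eq_mul,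
      convolution, ContinuousLinearMap.integral_apply hex]
    simp [ContinuousLinearMap.precompL_apply]
  have hmain : ∫ t, dbar φ t * (w - t)⁻¹ = 2 * Real.pi * φ w := by
    rw [← integral_sub_left_eq_self _ _ w]
    have h := integral_dbar_mul_inv (ψ := fun t ↦ φ (w - t))
      (hφ.comp (contDiff_const.sub contDiff_id))
      (hc.comp_homeomorph (Homeomorph.subLeft w))
    simp_rw [dbar_comp_const_sub hdiff] at h
    simp only [sub_sub_cancel]
    simp only [neg_mul, integral_neg, sub_zero, neg_inj] at h
    exact h
  have hsum : ∫ t, dbar φ t * (w - t)⁻¹ = (∫ t, fderiv ℝ φ t 1 * (w - t)⁻¹) +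
      Complex.I * ∫ t, fderiv ℝ φ t Complex.I * (w - t)⁻¹ := by
    rw [← integral_const_mul, ← integral_add (hi 1) ((hi _).const_mul _)]
    congr 1
    ext t
    rw [dbar]
    ring
  rw [dbar, hval, hval]
  have hpi : (2 * Real.pi : ℂ) ≠ 0 := by
    simp [Real.pi_ne_zero]
  calc _ = (2 * Real.pi : ℂ)⁻¹ * ((∫ t, fderiv ℝ φ t 1 * (w - t)⁻¹) +
        Complex.I * ∫ t, fderiv ℝ φ t Complex.I * (w - t)⁻¹) := by ring
    _ = φ w := by rw [← hsum, hmain, inv_mul_cancel_left₀ hpi]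

/-- If all the moments of `φ` vanish, so does its Cauchy transform near infinity. -/
lemma cauchyTransform_eq_zero {φ : ℂ → ℂ} (hφ : Continuous φ) {R : ℝ}
    (hR : tsupport φ ⊆ closedBall 0 R) (hp : ∀ n : ℕ, ∫ t, φ t * t ^ n = 0) {w : ℂ}
    (hw : R < ‖w‖) : cauchyTransform φ w = 0 := by
  have hc : HasCompactSupport φ :=
    (isCompact_closedBall (0 : ℂ) R).of_isClosed_subset (isClosed_tsupport φ) hR
  have hφR : ∀ t, φ t ≠ 0 → ‖t‖ ≤ R := fun t ht ↦
    mem_closedBall_zero_iff.1 (hR (subset_tsupport φ ht))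
  rcases lt_or_ge R 0 with hneg | hR0
  · have : ∀ t, φ t = 0 := fun t ↦ by
      by_contra h
      linarith [hφR t h, norm_nonneg t]
    simp [cauchyTransform, this]
  have hw0 : 0 < ‖w‖ := hR0.trans_lt hw
  have hwne : w ≠ 0 := norm_pos_iff.1 hw0
  have hcn : ∀ n : ℕ, Continuous fun t ↦ φ t * t ^ n := fun n ↦ by fun_prop
  have hsum : HasSum (fun n : ℕ ↦ ∫ t, (φ t * t ^ n) * (w ^ (n + 1))⁻¹)
      (∫ t, φ t * (w - t)⁻¹) := by
    have hb : ∀ n : ℕ, ∀ t, ‖(φ t * t ^ n) * (w ^ (n + 1))⁻¹‖ ≤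
        ‖φ t‖ * (‖w‖⁻¹ * (R / ‖w‖) ^ n) := by
      intro n t
      by_cases ht : φ t = 0
      · simp [ht]
      rw [norm_mul, norm_mul, norm_inv, norm_pow, norm_pow, mul_assoc, pow_succ, div_pow, mul_inv]
      have : ‖t‖ ^ n ≤ R ^ n := pow_le_pow_left₀ (norm_nonneg _) (hφR t ht) n
      have h2 : ‖t‖ ^ n * ((‖w‖ ^ n)⁻¹ * ‖w‖⁻¹) ≤ R ^ n * ((‖w‖ ^ n)⁻¹ * ‖w‖⁻¹) := by gcongr
      calc ‖φ t‖ * (‖t‖ ^ n * ((‖w‖ ^ n)⁻¹ * ‖w‖⁻¹))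
          ≤ ‖φ t‖ * (R ^ n * ((‖w‖ ^ n)⁻¹ * ‖w‖⁻¹)) := by gcongr
        _ = _ := by ring
    have hgeo : Summable fun n : ℕ ↦ ‖w‖⁻¹ * (R / ‖w‖) ^ n :=
      (summable_geometric_of_lt_one (by positivity) ((div_lt_one hw0).2 hw)).mul_left _
    have hn : Integrable fun t ↦ ‖φ t‖ := (hφ.integrable_of_hasCompactSupport hc).norm
    refine hasSum_integral_of_dominated_convergence
      (bound := fun n t ↦ ‖φ t‖ * (‖w‖⁻¹ * (R / ‖w‖) ^ n))
      (fun n ↦ ((hcn n).mul continuous_const).aestronglyMeasurable)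
      (fun n ↦ ae_of_all _ (hb n)) (ae_of_all _ fun t ↦ hgeo.mul_left _) ?_
      (ae_of_all _ fun t ↦ ?_)
    · simp_rw [tsum_mul_left]
      exact hn.mul_const _
    · by_cases ht : φ t = 0
      · simp [ht, hasSum_zero]
      have hlt : ‖t / w‖ < 1 := by
        rw [norm_div, div_lt_one hw0]
        exact (hφR t ht).trans_lt hw
      have h := ((hasSum_geometric_of_norm_lt_one hlt).mul_left (φ t * w⁻¹))
      have e1 : (fun n : ℕ ↦ φ t * t ^ n * (w ^ (n + 1))⁻¹) =
          fun n ↦ φ t * w⁻¹ * (t / w) ^ n := by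
        ext n
        rw [div_pow]
        field_simp
        ring
      have e2 : φ t * (w - t)⁻¹ = φ t * w⁻¹ * (1 - t / w)⁻¹ := by
        rw [mul_assoc, ← mul_inv, mul_sub, mul_one, mul_div_cancel₀ _ hwne]
      rw [e1, e2]
      exact h
  have h0 : ∀ n : ℕ, ∫ t, (φ t * t ^ n) * (w ^ (n + 1))⁻¹ = 0 := fun n ↦ by
    rw [integral_mul_const, hp n, zero_mul]
  simp_rw [h0] at hsum
  rw [cauchyTransform, hsum.unique hasSum_zero, mul_zero]

/-- The Cauchy transform of `φ` vanishes on connected sets that avoid the support of `φ` and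
reach far out. -/
lemma eqOn_zero_cauchyTransform {φ : ℂ → ℂ} (hφ : ContDiff ℝ 1 φ) {R : ℝ}
    (hR : tsupport φ ⊆ closedBall 0 R) (hp : ∀ n : ℕ, ∫ t, φ t * t ^ n = 0) {V : Set ℂ}
    (hV : IsPreconnected V) (hd : Disjoint V (tsupport φ)) {q : ℂ} (hq : q ∈ V) (hqR : R < ‖q‖) :
    EqOn (cauchyTransform φ) 0 V := by
  have hc : HasCompactSupport φ :=
    (isCompact_closedBall (0 : ℂ) R).of_isClosed_subset (isClosed_tsupport φ) hR
  have hdiff : DifferentiableOn ℂ (cauchyTransform φ) (tsupport φ)ᶜ := fun z hz ↦ by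
    refine ((dbar_eq_zero_iff ?_).1 ?_).differentiableWithinAt
    · exact (contDiff_cauchyTransform (n := 1) hφ hc).differentiable one_ne_zero z
    · rw [dbar_cauchyTransform hφ hc]
      exact image_eq_zero_of_notMem_tsupport hz
  have han := (hdiff.analyticOnNhd (isClosed_tsupport φ).isOpen_compl).mono
    (disjoint_left.1 hd : V ⊆ (tsupport φ)ᶜ)
  refine han.eqOn_zero_of_preconnected_of_eventuallyEq_zero hV hq ?_
  filter_upwards [(isOpen_lt continuous_const continuous_norm).mem_nhds hqR] with z hz
  exact cauchyTransform_eq_zero hφ.continuous hR hp hz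

/-! ### Poincaré inequalities -/

lemma sq_lintegral_mul_le {α : Type*} [MeasurableSpace α] (μ : Measure α) {f g : α → ENNReal}
    (hf : AEMeasurable f μ) (hg : AEMeasurable g μ) :
    (∫⁻ a, f a * g a ∂μ) ^ 2 ≤ (∫⁻ a, f a ^ 2 ∂μ) * ∫⁻ a, g a ^ 2 ∂μ := by
  have h := ENNReal.lintegral_mul_le_Lp_mul_Lq μ Real.HolderConjugate.two_two hf hg
  simp only [Pi.mul_apply, ENNReal.rpow_two] at h
  refine (pow_le_pow_left₀ zero_le h 2).trans_eq ?_
  rw [mul_pow, ← ENNReal.rpow_two, ← ENNReal.rpow_two, ← ENNReal.rpow_mul, ← ENNReal.rpow_mul]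
  norm_num

lemma lintegral_polar (c : ℂ) {f : ℂ → ENNReal} (hf : Measurable f) :
    ∫⁻ z, f z = ∫⁻ r in Ioi (0 : ℝ), ∫⁻ θ in Ioo (-Real.pi) Real.pi,
      ENNReal.ofReal r * f (c + r * circlePt θ) := by
  have hcirc := continuous_circlePt
  rw [← lintegral_add_left_eq_self _ c, ← Complex.lintegral_comp_polarCoord_symm,
    show polarCoord.target = Ioi (0 : ℝ) ×ˢ Ioo (-Real.pi) Real.pi from rfl,
    Measure.volume_eq_prod, ← Measure.prod_restrict]
  simp only [polarCoord_symm_eq, smul_eq_mul]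
  refine lintegral_prod _ (Measurable.aemeasurable ?_)
  have : Measurable fun p : ℝ × ℝ ↦ c + p.1 * circlePt p.2 :=
    Continuous.measurable (by fun_prop)
  exact (measurable_fst.ennreal_ofReal).mul (hf.comp this)

lemma enorm_sq_le_of_zero_on_circle {u : ℂ → ℂ} (hu : ContDiff ℝ 1 u) {c : ℂ} {s θ₀ θ : ℝ}
    (hs : 0 ≤ s) (hθ₀ : θ₀ ∈ Icc (-Real.pi) Real.pi) (h0 : u (c + s * circlePt θ₀) = 0)
    (hθ : θ ∈ Icc (-Real.pi) Real.pi) :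
    ‖u (c + s * circlePt θ)‖ₑ ^ 2 ≤ ENNReal.ofReal (2 * Real.pi * s ^ 2) *
      ∫⁻ φ in Ioo (-Real.pi) Real.pi, ‖fderiv ℝ u (c + s * circlePt φ)‖ₑ ^ 2 := by
  have hdiff := hu.differentiable one_ne_zero
  have hcont := hu.continuous_fderiv one_ne_zero
  have hcirc := continuous_circlePt
  have hcD : Continuous fun φ : ℝ ↦ fderiv ℝ u (c + s * circlePt φ) := by fun_prop
  have h := intervalIntegral.integral_eq_sub_of_hasDerivAt (a := θ₀) (b := θ)
    (fun φ _ ↦ hasDerivAt_comp_angle hdiff c s φ)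
    (Continuous.intervalIntegrable (by fun_prop) _ _)
  rw [h0, sub_zero] at h
  have hle : ‖u (c + s * circlePt θ)‖ₑ ≤ ∫⁻ φ in Ioo (-Real.pi) Real.pi,
      ENNReal.ofReal s * ‖fderiv ℝ u (c + s * circlePt φ)‖ₑ := by
    rw [← h]
    calc _ = ‖∫ φ in uIoc θ₀ θ, s * fderiv ℝ u (c + s * circlePt φ) (Complex.I * circlePt φ)‖ₑ := by
          rw [← ofReal_norm, intervalIntegral.norm_intervalIntegral_eq, ofReal_norm]
      _ ≤ ∫⁻ φ in uIoc θ₀ θ,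
          ‖s * fderiv ℝ u (c + s * circlePt φ) (Complex.I * circlePt φ)‖ₑ :=
        enorm_integral_le_lintegral_enorm _
      _ ≤ ∫⁻ φ in Icc (-Real.pi) Real.pi,
          ‖s * fderiv ℝ u (c + s * circlePt φ) (Complex.I * circlePt φ)‖ₑ := by
        refine lintegral_mono_set (uIoc_subset_uIcc.trans ?_)
        exact uIcc_subset_Icc hθ₀ hθ
      _ = ∫⁻ φ in Ioo (-Real.pi) Real.pi,
          ‖s * fderiv ℝ u (c + s * circlePt φ) (Complex.I * circlePt φ)‖ₑ := by
        rw [restrict_Ioo_eq_restrict_Icc]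
      _ ≤ _ := by
        refine lintegral_mono fun φ ↦ ?_
        rw [enorm_mul, ← ofReal_norm (s : ℂ), Complex.norm_real, Real.norm_of_nonneg hs]
        gcongr
        refine (ContinuousLinearMap.le_opENorm _ _).trans_eq ?_
        rw [enorm_mul, ← ofReal_norm (circlePt φ), norm_circlePt, ← ofReal_norm Complex.I,
          Complex.norm_I]
        simp
  refine (pow_le_pow_left₀ zero_le hle 2).trans ?_
  refine (sq_lintegral_mul_le _ aemeasurable_const
    (hcD.enorm.measurable.aemeasurable)).trans_eq ?_
  congr 1
  rw [setLIntegral_const, Real.volume_Ioo, ← ENNReal.ofReal_pow hs,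
    ← ENNReal.ofReal_mul (by positivity)]
  congr 1
  ring

lemma lintegral_annulus_le {u : ℂ → ℂ} (hu : ContDiff ℝ 1 u) {c : ℂ} {a b : ℝ}
    (hz : ∀ s ∈ Ioo a b, ∃ z, dist z c = s ∧ u z = 0) :
    ∫⁻ z in {z | dist z c ∈ Ioo a b}, ‖u z‖ₑ ^ 2 ≤ ENNReal.ofReal (4 * Real.pi ^ 2 * b ^ 2) *
      ∫⁻ z in {z | dist z c ∈ Ioo a b}, ‖fderiv ℝ u z‖ₑ ^ 2 := by
  have hcont := hu.continuous_fderiv one_ne_zero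
  have hcu := hu.continuous
  have hcirc := continuous_circlePt
  have hA : MeasurableSet {z | dist z c ∈ Ioo a b} :=
    (isOpen_Ioo.preimage (by fun_prop : Continuous fun z : ℂ ↦ dist z c)).measurableSet
  have hmem : ∀ r θ : ℝ, 0 < r → dist (c + r * circlePt θ) c = r := fun r θ hr ↦ by
    rw [dist_eq_norm, add_sub_cancel_left, norm_mul, norm_circlePt, mul_one, Complex.norm_real,
      Real.norm_of_nonneg hr.le]
  rw [← lintegral_indicator hA, ← lintegral_indicator hA,
    lintegral_polar c ((hcu.enorm.measurable.pow_const 2).indicator hA),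
    lintegral_polar c ((hcont.enorm.measurable.pow_const 2).indicator hA),
    ← lintegral_const_mul' _ _ ENNReal.ofReal_ne_top]
  refine setLIntegral_mono' measurableSet_Ioi fun r hr ↦ ?_
  by_cases hrI : r ∈ Ioo a b
  · have hin : ∀ θ, c + r * circlePt θ ∈ {z | dist z c ∈ Ioo a b} := fun θ ↦ by
      rw [mem_ofPred_eq, hmem r θ hr]
      exact hrI
    simp_rw [indicator_of_mem (hin _)]
    obtain ⟨z, hzr, hz0⟩ := hz r hrI
    have hz' : u (c + r * circlePt (Complex.arg (z - c))) = 0 := by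
      have : (r : ℂ) * circlePt (Complex.arg (z - c)) = z - c := by
        rw [← hzr, dist_eq_norm, circlePt]
        simp [Complex.norm_mul_cos_add_sin_mul_I]
      rw [this, add_sub_cancel, hz0]
    have hθ₀ : Complex.arg (z - c) ∈ Icc (-Real.pi) Real.pi :=
      ⟨(Complex.neg_pi_lt_arg _).le, Complex.arg_le_pi _⟩
    rw [lintegral_const_mul' _ _ ENNReal.ofReal_ne_top,
      lintegral_const_mul' _ _ ENNReal.ofReal_ne_top, mul_left_comm]
    refine mul_le_mul_right ?_ _
    calc ∫⁻ θ in Ioo (-Real.pi) Real.pi, ‖u (c + r * circlePt θ)‖ₑ ^ 2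
        ≤ ∫⁻ θ in Ioo (-Real.pi) Real.pi, ENNReal.ofReal (2 * Real.pi * r ^ 2) *
            ∫⁻ φ in Ioo (-Real.pi) Real.pi, ‖fderiv ℝ u (c + r * circlePt φ)‖ₑ ^ 2 :=
          setLIntegral_mono' measurableSet_Ioo fun θ hθ ↦
            enorm_sq_le_of_zero_on_circle hu (le_of_lt hr) hθ₀ hz' (Ioo_subset_Icc_self hθ)
      _ = ENNReal.ofReal (4 * Real.pi ^ 2 * r ^ 2) *
            ∫⁻ φ in Ioo (-Real.pi) Real.pi, ‖fderiv ℝ u (c + r * circlePt φ)‖ₑ ^ 2 := by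
          rw [setLIntegral_const, Real.volume_Ioo, mul_right_comm, ← ENNReal.ofReal_mul (by positivity)]
          congr 2
          ring
      _ ≤ _ := by
          have : 0 < r := hr
          have := hrI.2.le
          gcongr
  · have hout : ∀ θ, c + r * circlePt θ ∉ {z | dist z c ∈ Ioo a b} := fun θ ↦ by
      rw [mem_ofPred_eq, hmem r θ hr]
      exact hrI
    simp_rw [indicator_of_notMem (hout _)]
    simp

/-- A Poincaré inequality on a set `S` of points each of which has, at distance comparable to `δ`,
a ball of centres of annuli on all of whose circles `u` has a zero. -/
lemma lintegral_strip_le {u : ℂ → ℂ} (hu : ContDiff ℝ 1 u) {P S : Set ℂ} {δ : ℝ} (hδ : 0 < δ)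
    (hP : ∀ c ∈ P, ∀ s ∈ Ioo (δ / 2) (5 * δ), ∃ z, dist z c = s ∧ u z = 0)
    (hPm : MeasurableSet P) (hSm : MeasurableSet S)
    (hS : ∀ z ∈ S, ∃ ζ, ball ζ (δ / 8) ⊆ P ∧
      ∀ c ∈ ball ζ (δ / 8), dist z c ∈ Ioo (δ / 2) (5 * δ)) :
    ∫⁻ z in S, ‖u z‖ₑ ^ 2 ≤
      ENNReal.ofReal (160000 * Real.pi ^ 2 * δ ^ 2) * ∫⁻ z, ‖fderiv ℝ u z‖ₑ ^ 2 := by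
  have hcont := hu.continuous_fderiv one_ne_zero
  have hcu := hu.continuous
  set W : Set (ℂ × ℂ) := {p | dist p.2 p.1 ∈ Ioo (δ / 2) (5 * δ)} with hWdef
  have hW : MeasurableSet W := (isOpen_Ioo.preimage
    (by fun_prop : Continuous fun p : ℂ × ℂ ↦ dist p.2 p.1)).measurableSet
  have hA : ∀ c, MeasurableSet {z | dist z c ∈ Ioo (δ / 2) (5 * δ)} := fun c ↦
    (isOpen_Ioo.preimage (by fun_prop : Continuous fun z : ℂ ↦ dist z c)).measurableSet
  have hA' : ∀ z, MeasurableSet {c | dist z c ∈ Ioo (δ / 2) (5 * δ)} := fun z ↦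
    (isOpen_Ioo.preimage (by fun_prop : Continuous fun c : ℂ ↦ dist z c)).measurableSet
  have hswap : ∀ f : ℂ → ENNReal, Measurable f →
      ∫⁻ c in P, ∫⁻ z in {z | dist z c ∈ Ioo (δ / 2) (5 * δ)}, f z =
        ∫⁻ z, f z * volume (P ∩ {c | dist z c ∈ Ioo (δ / 2) (5 * δ)}) := by
    intro f hf
    have h1 : ∀ c, ∫⁻ z in {z | dist z c ∈ Ioo (δ / 2) (5 * δ)}, f z =
        ∫⁻ z, W.indicator (fun p ↦ f p.2) (c, z) := fun c ↦ by
      rw [← lintegral_indicator (hA c)]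
      rfl
    simp_rw [h1]
    rw [lintegral_lintegral_swap (f := fun c z ↦ W.indicator (fun p ↦ f p.2) (c, z))
      ((hf.comp measurable_snd).indicator hW).aemeasurable]
    refine lintegral_congr fun z ↦ ?_
    have h2 : ∀ c, W.indicator (fun p ↦ f p.2) (c, z) =
        {c | dist z c ∈ Ioo (δ / 2) (5 * δ)}.indicator (fun _ ↦ f z) c := fun c ↦ rfl
    simp_rw [h2]
    rw [lintegral_indicator (hA' z), Measure.restrict_restrict (hA' z), setLIntegral_const,
      inter_comm]
  have hlow : (∫⁻ z in S, ‖u z‖ₑ ^ 2) * (ENNReal.ofReal (δ / 8) ^ 2 * NNReal.pi) ≤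
      ∫⁻ z, ‖u z‖ₑ ^ 2 * volume (P ∩ {c | dist z c ∈ Ioo (δ / 2) (5 * δ)}) := by
    rw [← lintegral_mul_const _ (hcu.enorm.measurable.pow_const 2)]
    refine (setLIntegral_mono' hSm fun z hz ↦ ?_).trans (setLIntegral_le_lintegral S _)
    obtain ⟨ζ, hζP, hζ⟩ := hS z hz
    rw [← Complex.volume_ball ζ]
    gcongr
    exact subset_inter hζP hζ
  have hup : ∫⁻ z, ‖fderiv ℝ u z‖ₑ ^ 2 * volume (P ∩ {c | dist z c ∈ Ioo (δ / 2) (5 * δ)}) ≤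
      (∫⁻ z, ‖fderiv ℝ u z‖ₑ ^ 2) * (ENNReal.ofReal (5 * δ) ^ 2 * NNReal.pi) := by
    rw [← lintegral_mul_const _ (hcont.enorm.measurable.pow_const 2)]
    refine lintegral_mono fun z ↦ ?_
    rw [← Complex.volume_ball z]
    gcongr
    rintro c ⟨-, hc⟩
    rw [mem_ball, dist_comm]
    exact hc.2
  have hmid : ∫⁻ z, ‖u z‖ₑ ^ 2 * volume (P ∩ {c | dist z c ∈ Ioo (δ / 2) (5 * δ)}) ≤
      ENNReal.ofReal (4 * Real.pi ^ 2 * (5 * δ) ^ 2) *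
        ∫⁻ z, ‖fderiv ℝ u z‖ₑ ^ 2 * volume (P ∩ {c | dist z c ∈ Ioo (δ / 2) (5 * δ)}) := by
    rw [← hswap _ (hcu.enorm.measurable.pow_const 2),
      ← hswap _ (hcont.enorm.measurable.pow_const 2),
      ← lintegral_const_mul' _ _ ENNReal.ofReal_ne_top]
    exact setLIntegral_mono' hPm fun c hc ↦ lintegral_annulus_le hu (hP c hc)
  have hvol : ∀ r : ℝ, 0 ≤ r →
      ENNReal.ofReal r ^ 2 * NNReal.pi = ENNReal.ofReal (r ^ 2 * Real.pi) := fun r hr ↦ by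
    rw [ENNReal.ofReal_mul (by positivity), ENNReal.ofReal_pow hr,
      ← NNReal.coe_real_pi, ENNReal.ofReal_coe_nnreal]
  rw [hvol _ (by positivity)] at hlow hup
  have hpos : 0 < (δ / 8) ^ 2 * Real.pi := by positivity
  rw [← ENNReal.mul_le_mul_iff_left (c := ENNReal.ofReal ((δ / 8) ^ 2 * Real.pi))
    (ENNReal.ofReal_pos.2 hpos).ne' ENNReal.ofReal_ne_top]
  refine hlow.trans (hmid.trans ((mul_le_mul_right hup _).trans_eq ?_))
  generalize ∫⁻ z, ‖fderiv ℝ u z‖ₑ ^ 2 = J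
  rw [mul_comm J, ← mul_assoc, ← ENNReal.ofReal_mul (by positivity), mul_right_comm _ J,
    ← ENNReal.ofReal_mul (by positivity)]
  congr 2
  ring

/-! ### Mollification -/

/-- The mollification of `g` by the bump function `ρ`. -/
def mollify {E : Type*} [NormedAddCommGroup E] [NormedSpace ℝ E] (ρ : ContDiffBump (0 : ℂ))
    (g : ℂ → E) : ℂ → E :=
  convolution (ρ.normed volume) g (ContinuousLinearMap.lsmul ℝ ℝ) volume

section Mollify

variable {E : Type*} [NormedAddCommGroup E] [NormedSpace ℝ E]

lemma mollify_apply (ρ : ContDiffBump (0 : ℂ)) (g : ℂ → E) (z : ℂ) :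
    mollify ρ g z = ∫ t, ρ.normed volume t • g (z - t) := rfl

lemma contDiff_mollify (ρ : ContDiffBump (0 : ℂ)) {g : ℂ → E} (hg : LocallyIntegrable g)
    (n : ℕ∞) : ContDiff ℝ n (mollify ρ g) :=
  ρ.hasCompactSupport_normed.contDiff_convolution_left _ ρ.contDiff_normed hg

lemma tsupport_mollify_subset (ρ : ContDiffBump (0 : ℂ)) {g : ℂ → E} {K : Set ℂ}
    (hg : ∀ z ∉ K, g z = 0) : tsupport (mollify ρ g) ⊆ cthickening ρ.rOut K := by
  refine closure_minimal (fun z hz ↦ ?_) isClosed_cthickening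
  obtain ⟨t, ht, s, hs, rfl⟩ := support_convolution_subset (ContinuousLinearMap.lsmul ℝ ℝ) hz
  rw [ρ.support_normed_eq, mem_ball_zero_iff] at ht
  have hsK : s ∈ K := by
    by_contra h
    exact hs (hg s h)
  refine mem_cthickening_of_dist_le _ s _ _ hsK ?_
  simpa using ht.le

lemma integrable_normed (ρ : ContDiffBump (0 : ℂ)) : Integrable (ρ.normed volume) :=
  ρ.continuous_normed.integrable_of_hasCompactSupport ρ.hasCompactSupport_normed

/-- Integrating a mollification against `F` averages the integrals against translates of `F`. -/
lemma norm_integral_mollify_mul_sub_le (ρ : ContDiffBump (0 : ℂ)) {g F : ℂ → ℂ}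
    (hg : Integrable g) (hgc : HasCompactSupport g) (hF : Continuous F) {A : ℂ} {η : ℝ}
    (h : ∀ t ∈ ball (0 : ℂ) ρ.rOut, ‖(∫ y, g y * F (y + t)) - A‖ ≤ η) :
    ‖(∫ z, mollify ρ g z * F z) - A‖ ≤ η := by
  have hρ := integrable_normed ρ
  obtain ⟨C, hC⟩ := (hgc.isCompact.cthickening (r := ρ.rOut)).exists_bound_of_continuousOn
    hF.continuousOn
  have hinteg : Integrable (fun p : ℂ × ℂ ↦ (ρ.normed volume p.2 • g (p.1 - p.2)) * F p.1)
      (volume.prod volume) := by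
    have h0 := Integrable.convolution_integrand (ContinuousLinearMap.lsmul ℝ ℝ) hρ hg
    refine (h0.norm.const_mul C).mono'
      (h0.aestronglyMeasurable.mul (hF.comp continuous_fst).aestronglyMeasurable)
      (ae_of_all _ fun p ↦ ?_)
    simp only [ContinuousLinearMap.lsmul_apply]
    rw [norm_mul, mul_comm]
    by_cases h1 : ρ.normed volume p.2 = 0
    · simp [h1]
    by_cases h2 : g (p.1 - p.2) = 0
    · simp [h2]
    have hp : p.2 ∈ ball (0 : ℂ) ρ.rOut := by
      rw [← ρ.support_normed_eq (μ := volume)]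
      exact h1
    rw [mem_ball_zero_iff] at hp
    refine mul_le_mul_of_nonneg_right (hC p.1 ?_) (norm_nonneg _)
    refine mem_cthickening_of_dist_le _ (p.1 - p.2) _ _ (subset_tsupport g h2) ?_
    simpa [dist_eq_norm] using hp.le
  have hswap : ∫ z, mollify ρ g z * F z =
      ∫ t, ρ.normed volume t • ∫ y, g y * F (y + t) := by
    simp_rw [mollify_apply, ← integral_mul_const]
    rw [integral_integral_swap hinteg]
    congr 1
    ext t
    rw [← integral_smul, ← integral_add_right_eq_self _ t]
    congr 1
    ext y
    rw [add_sub_cancel_right, smul_mul_assoc]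
  have hinteg' : Integrable fun t ↦ ρ.normed volume t • ∫ y, g y * F (y + t) := by
    refine hinteg.integral_prod_right.congr (ae_of_all _ fun t ↦ ?_)
    simp only
    rw [← integral_smul, ← integral_add_right_eq_self _ t]
    congr 1
    ext y
    rw [add_sub_cancel_right, smul_mul_assoc]
  have hA : A = ∫ t, ρ.normed volume t • A := by
    rw [integral_smul_const, ρ.integral_normed, one_smul]
  rw [hswap, hA, ← integral_sub hinteg' (hρ.smul_const A)]
  have hη : η = ∫ t, ρ.normed volume t * η := by
    rw [integral_mul_const, ρ.integral_normed, one_mul]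
  rw [hη]
  refine norm_integral_le_of_norm_le (hρ.mul_const η) (ae_of_all _ fun t ↦ ?_)
  rw [← smul_sub, norm_smul, Real.norm_of_nonneg (ρ.nonneg_normed t)]
  by_cases ht : ρ.normed volume t = 0
  · simp [ht]
  refine mul_le_mul_of_nonneg_left (h t ?_) (ρ.nonneg_normed t)
  rw [← ρ.support_normed_eq (μ := volume)]
  exact ht

lemma lintegral_enorm_mollify_sq_le (ρ : ContDiffBump (0 : ℂ)) {g : ℂ → ℂ} (hg : Measurable g) :
    ∫⁻ z, ‖mollify ρ g z‖ₑ ^ 2 ≤ ∫⁻ z, ‖g z‖ₑ ^ 2 := by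
  have hρc : Continuous (ρ.normed volume) := ρ.continuous_normed
  have hone : ∫⁻ t, ENNReal.ofReal (ρ.normed volume t) = 1 := by
    rw [← ofReal_integral_eq_lintegral_ofReal (integrable_normed ρ)
      (ae_of_all _ fun t ↦ ρ.nonneg_normed t), ρ.integral_normed, ENNReal.ofReal_one]
  set s : ℂ → ENNReal := fun t ↦ ENNReal.ofReal (Real.sqrt (ρ.normed volume t)) with hs
  have hsm : Measurable s := (Continuous.measurable (by fun_prop)).ennreal_ofReal
  have hs2 : ∀ t, s t ^ 2 = ENNReal.ofReal (ρ.normed volume t) := fun t ↦ by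
    rw [hs, ← ENNReal.ofReal_pow (Real.sqrt_nonneg _), Real.sq_sqrt (ρ.nonneg_normed t)]
  have hpt : ∀ z, ‖mollify ρ g z‖ₑ ^ 2 ≤
      ∫⁻ t, ENNReal.ofReal (ρ.normed volume t) * ‖g (z - t)‖ₑ ^ 2 := by
    intro z
    have hgm : Measurable fun t ↦ ‖g (z - t)‖ₑ := (hg.comp (measurable_const.sub measurable_id)).enorm
    have h1 : ‖mollify ρ g z‖ₑ ≤ ∫⁻ t, s t * (s t * ‖g (z - t)‖ₑ) := by
      refine (enorm_integral_le_lintegral_enorm _).trans_eq (lintegral_congr fun t ↦ ?_)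
      rw [ContinuousLinearMap.lsmul_apply, enorm_smul, ← mul_assoc, ← sq, hs2,
        Real.enorm_of_nonneg (ρ.nonneg_normed t)]
    refine (pow_le_pow_left₀ zero_le h1 2).trans ?_
    refine (sq_lintegral_mul_le _ hsm.aemeasurable (hsm.mul hgm).aemeasurable).trans_eq ?_
    simp only [Pi.mul_apply, mul_pow, hs2, hone, one_mul]
  refine (lintegral_mono hpt).trans_eq ?_
  rw [lintegral_lintegral_swap]
  · have : ∀ t, ∫⁻ z, ENNReal.ofReal (ρ.normed volume t) * ‖g (z - t)‖ₑ ^ 2 =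
        ENNReal.ofReal (ρ.normed volume t) * ∫⁻ z, ‖g z‖ₑ ^ 2 := fun t ↦ by
      rw [lintegral_const_mul' _ _ ENNReal.ofReal_ne_top,
        lintegral_sub_right_eq_self (fun z ↦ ‖g z‖ₑ ^ 2) t]
    rw [lintegral_congr this, lintegral_mul_const _ hρc.measurable.ennreal_ofReal, hone, one_mul]
  · refine Measurable.aemeasurable ?_
    exact (hρc.measurable.comp measurable_snd).ennreal_ofReal.mul
      ((hg.comp (measurable_fst.sub measurable_snd)).enorm.pow_const 2)

end Mollify

/-! ### Cutoff functions and escape routes -/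

lemma exists_cutoff (A : Set ℂ) {δ : ℝ} (hδ : 0 < δ) : ∃ χ : ℂ → ℝ, ContDiff ℝ 2 χ ∧
    (∀ z, ‖χ z‖ ≤ 1) ∧ (∀ z, infDist z A ≤ δ → χ z = 0) ∧
    (∀ z, 4 * δ ≤ infDist z A → χ z = 1) ∧ ∀ z, ‖fderiv ℝ χ z‖ ≤ 1 / δ := by
  set k : ℂ → ℝ := fun z ↦ max 0 (min 1 ((infDist z A - 2 * δ) / δ)) with hk
  have hdl : ∀ z w, infDist z A ≤ infDist w A + dist z w := fun z w ↦ infDist_le_infDist_add_dist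
  have hkc : Continuous k := by
    have := continuous_infDist_pt A
    fun_prop
  have hk0 : ∀ z, 0 ≤ k z := fun z ↦ le_max_left _ _
  have hk1 : ∀ z, k z ≤ 1 := fun z ↦ max_le zero_le_one (min_le_left _ _)
  have hkz : ∀ z, infDist z A ≤ 2 * δ → k z = 0 := fun z hz ↦ by
    refine max_eq_left ((min_le_right _ _).trans ?_)
    exact div_nonpos_of_nonpos_of_nonneg (by linarith) hδ.le
  have hko : ∀ z, 3 * δ ≤ infDist z A → k z = 1 := fun z hz ↦ by
    have : 1 ≤ (infDist z A - 2 * δ) / δ := (one_le_div hδ).2 (by linarith)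
    simp only [hk]
    rw [min_eq_left this, max_eq_right zero_le_one]
  have hkl : ∀ z w, |k z - k w| ≤ 1 / δ * dist z w := fun z w ↦ by
    have h1 : |infDist z A - infDist w A| ≤ dist z w := by
      rw [abs_le]
      have := hdl z w
      have := hdl w z
      rw [dist_comm w z] at this
      constructor <;> linarith
    calc |k z - k w| ≤ |min 1 ((infDist z A - 2 * δ) / δ) - min 1 ((infDist w A - 2 * δ) / δ)| := by
          refine (abs_max_sub_max_le_max _ _ _ _).trans ?_
          simp
      _ ≤ |(infDist z A - 2 * δ) / δ - (infDist w A - 2 * δ) / δ| := by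
          refine (abs_min_sub_min_le_max _ _ _ _).trans ?_
          simp
      _ = 1 / δ * |infDist z A - infDist w A| := by
          rw [← sub_div, abs_div, abs_of_pos hδ]
          ring_nf
      _ ≤ _ := by gcongr
  let ρ : ContDiffBump (0 : ℂ) := ⟨δ / 2, δ, by linarith, by linarith⟩
  have hρ := integrable_normed ρ
  have hi : ∀ z, Integrable fun t ↦ ρ.normed volume t • k (z - t) := fun z ↦ by
    refine Continuous.integrable_of_hasCompactSupport ?_ ρ.hasCompactSupport_normed.smul_right
    have : Continuous (ρ.normed volume) := ρ.continuous_normed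
    fun_prop
  have hconst : ∀ z x, (∀ w ∈ ball z δ, k w = x) → mollify ρ k z = x := fun z x h ↦ by
    have hz := h z (mem_ball_self hδ)
    rw [← hz]
    exact ρ.normed_convolution_eq_right fun w hw ↦ by rw [h w hw, hz]
  refine ⟨mollify ρ k, contDiff_mollify ρ hkc.locallyIntegrable 2, fun z ↦ ?_, fun z hz ↦ ?_,
    fun z hz ↦ ?_, fun z ↦ ?_⟩
  · rw [← ρ.integral_normed (μ := volume)]
    refine norm_integral_le_of_norm_le hρ (ae_of_all _ fun t ↦ ?_)
    rw [ContinuousLinearMap.lsmul_apply, norm_smul, Real.norm_of_nonneg (ρ.nonneg_normed t),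
      Real.norm_of_nonneg (hk0 _)]
    exact mul_le_of_le_one_right (ρ.nonneg_normed t) (hk1 _)
  · refine hconst z 0 fun w hw ↦ hkz w ?_
    have := hdl w z
    have := mem_ball.1 hw
    linarith
  · refine hconst z 1 fun w hw ↦ hko w ?_
    have := hdl z w
    have := mem_ball'.1 hw
    linarith
  · have hlip : LipschitzWith (1 / δ).toNNReal (mollify ρ k) := by
      refine LipschitzWith.of_dist_le_mul fun z w ↦ ?_
      rw [Real.coe_toNNReal _ (by positivity), dist_eq_norm, mollify_apply, mollify_apply,
        ← integral_sub (hi z) (hi w)]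
      have hone : 1 / δ * dist z w = ∫ t, ρ.normed volume t * (1 / δ * dist z w) := by
        rw [integral_mul_const, ρ.integral_normed, one_mul]
      rw [hone]
      refine norm_integral_le_of_norm_le (hρ.mul_const _) (ae_of_all _ fun t ↦ ?_)
      rw [← smul_sub, norm_smul, Real.norm_of_nonneg (ρ.nonneg_normed t)]
      refine mul_le_mul_of_nonneg_left ?_ (ρ.nonneg_normed t)
      simpa using hkl (z - t) (w - t)
    have := norm_fderiv_le_of_lipschitz ℝ hlip (x₀ := z)
    rwa [Real.coe_toNNReal _ (by positivity)] at this

/-- From all points near a compact subset `B` of the closure of the connected open set `Kᶜ`, one can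
escape to infinity while staying uniformly away from `K`. -/
lemma exists_escape {K B : Set ℂ} (hK : IsCompact K) (hc : IsPreconnected Kᶜ) (hB : IsCompact B)
    (hBK : B ⊆ closure Kᶜ) {δ : ℝ} (hδ : 0 < δ) (R : ℝ) :
    ∃ r > 0, ∀ ζ ∈ B, ∃ Γ : Set ℂ, IsPreconnected Γ ∧ Disjoint Γ (cthickening r K) ∧
      (∃ p ∈ Γ, dist p ζ < δ) ∧ ∃ q ∈ Γ, R < ‖q‖ := by
  obtain ⟨R', hR', hKR⟩ := exists_pos_subset_closedBall hK.isBounded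
  obtain ⟨q, hqK, hqR⟩ : ∃ q ∈ Kᶜ, R < ‖q‖ := by
    have hn : ‖((max R R' + 1 : ℝ) : ℂ)‖ = max R R' + 1 := by
      rw [Complex.norm_real, Real.norm_of_nonneg (by linarith [le_max_right R R'])]
    refine ⟨((max R R' + 1 : ℝ) : ℂ), fun h ↦ ?_, ?_⟩
    · have := mem_closedBall_zero_iff.1 (hKR h)
      linarith [le_max_right R R']
    · linarith [le_max_left R R']
  have hpath : IsPathConnected Kᶜ :=
    hK.isClosed.isOpen_compl.isConnected_iff_isPathConnected.1 ⟨⟨q, hqK⟩, hc⟩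
  refine hB.induction_on (p := fun S ↦ ∃ r > 0, ∀ ζ ∈ S, ∃ Γ : Set ℂ, IsPreconnected Γ ∧
    Disjoint Γ (cthickening r K) ∧ (∃ p ∈ Γ, dist p ζ < δ) ∧ ∃ q ∈ Γ, R < ‖q‖) ?_ ?_ ?_ ?_
  · exact ⟨1, one_pos, by simp⟩
  · rintro S T hST ⟨r, hr, h⟩
    exact ⟨r, hr, fun ζ hζ ↦ h ζ (hST hζ)⟩
  · rintro S T ⟨r, hr, h⟩ ⟨r', hr', h'⟩
    refine ⟨min r r', lt_min hr hr', ?_⟩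
    rintro ζ (hζ | hζ)
    · obtain ⟨Γ, h1, h2, h3⟩ := h ζ hζ
      exact ⟨Γ, h1, h2.mono_right (cthickening_mono (min_le_left _ _) _), h3⟩
    · obtain ⟨Γ, h1, h2, h3⟩ := h' ζ hζ
      exact ⟨Γ, h1, h2.mono_right (cthickening_mono (min_le_right _ _) _), h3⟩
  · intro ζ hζ
    obtain ⟨p, hpK, hp⟩ := Metric.mem_closure_iff.1 (hBK hζ) (δ / 2) (half_pos hδ)
    obtain ⟨γ, hγ⟩ := hpath.joinedIn p hpK q hqK
    have hcomp : IsCompact (range γ) := isCompact_range γ.continuous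
    have hdisj : Disjoint (range γ) K := by
      rw [disjoint_left]
      rintro _ ⟨t, rfl⟩
      exact hγ t
    obtain ⟨r, hr, hrd⟩ := hdisj.exists_cthickenings hcomp hK.isClosed
    refine ⟨_, mem_nhdsWithin_of_mem_nhds (ball_mem_nhds ζ (half_pos hδ)), r, hr, fun ζ' hζ' ↦ ?_⟩
    refine ⟨range γ, isPreconnected_range γ.continuous,
      hrd.mono_left (self_subset_cthickening _), ⟨p, ⟨0, γ.source⟩, ?_⟩, q, ⟨1, γ.target⟩, hqR⟩
    have h1 := dist_triangle p ζ ζ'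
    rw [dist_comm] at hp
    have h2 := mem_ball'.1 hζ'
    linarith

lemma exists_infDist_eq_dist_frontier {G : Set ℂ} (hG : IsOpen G) (hne : Gᶜ.Nonempty) {z : ℂ}
    (hz : 0 < infDist z Gᶜ) : ∃ ζ ∈ frontier G, infDist z Gᶜ = dist z ζ := by
  obtain ⟨ζ, hζ, hd⟩ := hG.isClosed_compl.exists_infDist_eq_dist hne z
  refine ⟨ζ, ?_, hd⟩
  rw [hG.frontier_eq]
  refine ⟨?_, hζ⟩
  have hb : ball z (infDist z Gᶜ) ⊆ G := by
    have := disjoint_ball_infDist (x := z) (s := Gᶜ)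
    exact disjoint_compl_right_iff_subset.1 this
  refine closure_mono hb ?_
  rw [closure_ball _ hz.ne', mem_closedBall, dist_comm]
  exact hd.ge

/-! ### Functions orthogonal to the polynomials -/

lemma HasCompactSupport.cauchyTransform {φ : ℂ → ℂ} {R : ℝ} (hφ : Continuous φ)
    (hR : tsupport φ ⊆ closedBall 0 R) (hp : ∀ n : ℕ, ∫ t, φ t * t ^ n = 0) :
    HasCompactSupport (cauchyTransform φ) := by
  refine HasCompactSupport.intro (isCompact_closedBall (0 : ℂ) R) fun z hz ↦ ?_
  rw [mem_closedBall_zero_iff, not_le] at hz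
  exact cauchyTransform_eq_zero hφ hR hp hz

/-- The Cauchy transform of a function orthogonal to the polynomials is small near the boundary
of `G`, uniformly over all such functions supported sufficiently near `closure G`. -/
lemma exists_lintegral_strip_cauchyTransform_le {G : Set ℂ} (hGo : IsOpen G)
    (hGb : Bornology.IsBounded G) (hGc : IsPreconnected (closure G)ᶜ)
    (hGf : frontier G ⊆ closure (closure G)ᶜ) {δ : ℝ} (hδ : 0 < δ) :
    ∃ r > 0, ∀ φ : ℂ → ℂ, ContDiff ℝ 2 φ → tsupport φ ⊆ cthickening r (closure G) →
      (∀ n : ℕ, ∫ t, φ t * t ^ n = 0) → HasCompactSupport (cauchyTransform φ) ∧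
      ∫⁻ z in {z | infDist z Gᶜ ∈ Icc δ (4 * δ)}, ‖cauchyTransform φ z‖ₑ ^ 2 ≤
        ENNReal.ofReal (160000 * Real.pi ^ 2 * δ ^ 2) * ∫⁻ z, ‖φ z‖ₑ ^ 2 := by
  have hK : IsCompact (closure G) := hGb.isCompact_closure
  have hB : IsCompact (frontier G) := hK.of_isClosed_subset isClosed_frontier frontier_subset_closure
  obtain ⟨R₀, hR₀, hKR⟩ := exists_pos_subset_closedBall hK.isBounded
  obtain ⟨r₀, hr₀, hesc⟩ := exists_escape hK hGc hB hGf (δ := δ / 4) (by linarith) (R₀ + 1 + 6 * δ)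
  have hne : Gᶜ.Nonempty := by
    by_contra h
    rw [not_nonempty_iff_eq_empty, compl_empty_iff] at h
    exact NormedSpace.unbounded_univ ℝ ℂ (h ▸ hGb)
  refine ⟨min r₀ 1, lt_min hr₀ one_pos, fun φ hφ hsupp hmom ↦ ?_⟩
  have hR : tsupport φ ⊆ closedBall 0 (R₀ + 1) := by
    refine hsupp.trans ((cthickening_mono (min_le_right _ _) _).trans ?_)
    refine (cthickening_subset_of_subset _ hKR).trans ?_
    rw [cthickening_closedBall zero_le_one hR₀.le, add_comm]
  have hcs : HasCompactSupport (cauchyTransform φ) := .cauchyTransform hφ.continuous hR hmom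
  have hφc : HasCompactSupport φ := HasCompactSupport.of_support_subset_isCompact
    (isCompact_closedBall (0 : ℂ) (R₀ + 1)) ((subset_tsupport φ).trans hR)
  have hu : ContDiff ℝ 2 (cauchyTransform φ) := contDiff_cauchyTransform (n := 2) hφ hφc
  refine ⟨hcs, ?_⟩
  refine (lintegral_strip_le (P := thickening (δ / 8) (frontier G)) (hu.of_le (by norm_num)) hδ
    ?_ isOpen_thickening.measurableSet ?_ ?_).trans ?_
  · rintro c hc s ⟨hs1, hs2⟩
    obtain ⟨ζ, hζ, hcζ⟩ := mem_thickening_iff.1 hc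
    obtain ⟨Γ, hΓ, hΓd, ⟨p, hpΓ, hp⟩, q, hqΓ, hq⟩ := hesc ζ hζ
    have hzero := eqOn_zero_cauchyTransform (hφ.of_le (by norm_num)) hR hmom hΓ
      (hΓd.mono_right (hsupp.trans (cthickening_mono (min_le_left _ _) _))) hqΓ (by linarith)
    have hζR : ‖ζ‖ ≤ R₀ := mem_closedBall_zero_iff.1 (hKR (frontier_subset_closure hζ))
    have hpc : dist p c ≤ s := by
      have := dist_triangle p ζ c
      rw [dist_comm ζ c] at this
      linarith
    have hqc : s ≤ dist q c := by
      have h1 := norm_sub_norm_le q c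
      have h2 := norm_sub_norm_le c ζ
      rw [dist_eq_norm] at hcζ ⊢
      linarith
    have hcont : ContinuousOn (fun z : ℂ ↦ dist z c) Γ := by fun_prop
    obtain ⟨z, hz, hzs⟩ := hΓ.intermediate_value hpΓ hqΓ hcont ⟨hpc, hqc⟩
    exact ⟨z, hzs, hzero hz⟩
  · exact (isClosed_Icc.preimage (continuous_infDist_pt Gᶜ)).measurableSet
  · rintro z ⟨hz1, hz2⟩
    obtain ⟨ζ, hζ, hd⟩ := exists_infDist_eq_dist_frontier hGo hne (hδ.trans_le hz1)
    refine ⟨ζ, ball_subset_thickening hζ _, fun c hc ↦ ?_⟩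
    rw [mem_ball] at hc
    have h1 := dist_triangle z c ζ
    have h2 := dist_triangle z ζ c
    rw [dist_comm ζ c] at h2
    constructor <;> linarith
  · refine mul_le_mul_right ?_ _
    refine (lintegral_enorm_fderiv_sq_le hu hcs).trans_eq ?_
    rw [dbar_cauchyTransform (hφ.of_le (by norm_num)) hφc]

/-- Integration by parts against the Cauchy transform. -/
lemma enorm_integral_mul_sq_le {φ F : ℂ → ℂ} (hφ : ContDiff ℝ 2 φ) (hφc : HasCompactSupport φ)
    (hu : HasCompactSupport (cauchyTransform φ)) (hF : ContDiff ℝ 1 F) {S : Set ℂ}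
    (hFS : ∀ z ∉ S, dbar F z = 0) :
    ‖∫ z, φ z * F z‖ₑ ^ 2 ≤
      (∫⁻ z in S, ‖cauchyTransform φ z‖ₑ ^ 2) * ∫⁻ z in S, ‖dbar F z‖ₑ ^ 2 := by
  have huc : ContDiff ℝ 2 (cauchyTransform φ) := contDiff_cauchyTransform (n := 2) hφ hφc
  have huc1 : ContDiff ℝ 1 (cauchyTransform φ) := huc.of_le (by norm_num)
  have hdF : Continuous (dbar F) := continuous_dbar hF
  have h0 := integral_dbar_eq_zero (huc1.mul hF) hu.mul_right
  have h1 : ∀ z, dbar (fun w ↦ cauchyTransform φ w * F w) z =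
      φ z * F z + cauchyTransform φ z * dbar F z := fun z ↦ by
    rw [dbar_mul (huc1.differentiable (by norm_num) z) (hF.differentiable (by norm_num) z),
      dbar_cauchyTransform (hφ.of_le (by norm_num)) hφc]
  simp only [h1] at h0
  have hi1 : Integrable fun z ↦ φ z * F z :=
    (hφ.continuous.mul hF.continuous).integrable_of_hasCompactSupport hφc.mul_right
  have hi2 : Integrable fun z ↦ cauchyTransform φ z * dbar F z :=
    (huc.continuous.mul hdF).integrable_of_hasCompactSupport hu.mul_right
  rw [integral_add hi1 hi2] at h0
  rw [eq_neg_of_add_eq_zero_left h0, enorm_neg,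
    ← setIntegral_eq_integral_of_forall_compl_eq_zero (s := S) fun z hz ↦ by simp [hFS z hz]]
  refine le_trans ?_ (sq_lintegral_mul_le (volume.restrict S)
    (f := fun z ↦ ‖cauchyTransform φ z‖ₑ) (g := fun z ↦ ‖dbar F z‖ₑ)
    huc.continuous.measurable.enorm.aemeasurable hdF.measurable.enorm.aemeasurable)
  gcongr
  refine (enorm_integral_le_lintegral_enorm _).trans_eq ?_
  simp only [enorm_mul]

lemma exists_cutoff_mul {G : Set ℂ} (hGo : IsOpen G) (hGb : Bornology.IsBounded G) {f : ℂ → ℂ}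
    (hf : DifferentiableOn ℂ f G) {δ : ℝ} (hδ : 0 < δ) : ∃ χ : ℂ → ℝ, Continuous χ ∧
      (∀ z, ‖χ z‖ ≤ 1) ∧ (∀ z, infDist z Gᶜ ≤ δ → χ z = 0) ∧
      (∀ z, 4 * δ ≤ infDist z Gᶜ → χ z = 1) ∧
      ContDiff ℝ 1 (fun z ↦ f z * (χ z : ℂ)) ∧ HasCompactSupport (fun z ↦ f z * (χ z : ℂ)) ∧
      (∀ z, infDist z Gᶜ ∉ Icc δ (4 * δ) → dbar (fun z ↦ f z * (χ z : ℂ)) z = 0) ∧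
      ∀ z, ‖dbar (fun z ↦ f z * (χ z : ℂ)) z‖ ≤ 2 / δ * ‖f z‖ := by
  obtain ⟨χ, hχ, hχ1, hχz, hχo, hχd⟩ := exists_cutoff Gᶜ hδ
  have hd : Continuous fun z : ℂ ↦ infDist z Gᶜ := continuous_infDist_pt Gᶜ
  have hmem : ∀ z, 0 < infDist z Gᶜ → z ∈ G := fun z hz ↦ by
    by_contra h
    exact hz.ne' (infDist_zero_of_mem h)
  have hχC : ContDiff ℝ 2 fun z ↦ (χ z : ℂ) := Complex.ofRealCLM.contDiff.comp hχ
  have hχD : ∀ z, DifferentiableAt ℝ (fun z ↦ (χ z : ℂ)) z := hχC.differentiable (by norm_num)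
  have hnear : ∀ z, infDist z Gᶜ < δ → (fun z ↦ f z * (χ z : ℂ)) =ᶠ[nhds z] fun _ ↦ 0 :=
    fun z hz ↦ by
      filter_upwards [(isOpen_Iio.preimage hd).mem_nhds hz] with w hw
      rw [hχz w (le_of_lt hw), Complex.ofReal_zero, mul_zero]
  have hfar : ∀ z, 4 * δ < infDist z Gᶜ → (fun z ↦ f z * (χ z : ℂ)) =ᶠ[nhds z] f :=
    fun z hz ↦ by
      filter_upwards [(isOpen_Ioi.preimage hd).mem_nhds hz] with w hw
      rw [hχo w (le_of_lt hw), Complex.ofReal_one, mul_one]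
  have hfan : ∀ z ∈ G, AnalyticAt ℂ f z := fun z hz ↦ hf.analyticAt (hGo.mem_nhds hz)
  have hdz : ∀ z, infDist z Gᶜ < δ → dbar (fun z ↦ f z * (χ z : ℂ)) z = 0 := fun z hz ↦ by
    rw [dbar_congr (hnear z hz)]
    exact (dbar_eq_zero_iff (differentiableAt_const _)).2 (differentiableAt_const _)
  refine ⟨χ, hχ.continuous, hχ1, hχz, hχo, ?_, ?_, fun z hz ↦ ?_, fun z ↦ ?_⟩
  · rw [contDiff_iff_contDiffAt]
    intro z
    rcases lt_or_ge (infDist z Gᶜ) δ with hz | hz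
    · exact contDiffAt_const.congr_of_eventuallyEq (hnear z hz)
    · exact ((hfan z (hmem z (hδ.trans_le hz))).contDiffAt.restrict_scalars ℝ).mul
        ((hχC.of_le (by norm_num)).contDiffAt)
  · refine HasCompactSupport.intro hGb.isCompact_closure fun z hz ↦ ?_
    rw [hχz z, Complex.ofReal_zero, mul_zero]
    rw [infDist_zero_of_mem (s := Gᶜ) fun h ↦ hz (subset_closure h)]
    exact hδ.le
  · rw [mem_Icc, not_and_or, not_le, not_le] at hz
    rcases hz with hz | hz
    · exact hdz z hz
    · rw [dbar_congr (hfar z hz)]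
      have := (hfan z (hmem z (by linarith))).differentiableAt
      exact (dbar_eq_zero_iff (this.restrictScalars ℝ)).2 this
  · rcases lt_or_ge (infDist z Gᶜ) δ with hz | hz
    · rw [hdz z hz, norm_zero]
      positivity
    · have hfd := (hfan z (hmem z (hδ.trans_le hz))).differentiableAt
      rw [dbar_mul (hfd.restrictScalars ℝ) (hχD z),
        (dbar_eq_zero_iff (hfd.restrictScalars ℝ)).2 hfd, zero_mul, zero_add, norm_mul, mul_comm]
      gcongr
      refine (norm_dbar_le _ z).trans ?_
      have hχz : DifferentiableAt ℝ χ z := hχ.differentiable (by norm_num) z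
      have h1 : fderiv ℝ (fun z ↦ (χ z : ℂ)) z = Complex.ofRealCLM ∘L fderiv ℝ χ z :=
        (Complex.ofRealCLM.hasFDerivAt.comp z hχz.hasFDerivAt).fderiv
      have h2 : ‖fderiv ℝ (fun z ↦ (χ z : ℂ)) z‖ ≤ 1 / δ := by
        rw [h1]
        refine (ContinuousLinearMap.opNorm_comp_le _ _).trans ?_
        rw [Complex.ofRealCLM_norm, one_mul]
        exact hχd z
      calc 2 * ‖fderiv ℝ (fun z ↦ (χ z : ℂ)) z‖ ≤ 2 * (1 / δ) := by gcongr
        _ = 2 / δ := by ring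

/-- If `g` is orthogonal to the polynomials, so is each of its mollifications. -/
lemma integral_mollify_mul_pow_eq_zero (ρ : ContDiffBump (0 : ℂ)) {g : ℂ → ℂ}
    (hg : Integrable g) (hgc : HasCompactSupport g)
    (hp : ∀ p : ℂ[X], ∫ z, g z * p.eval z = 0) (n : ℕ) : ∫ z, mollify ρ g z * z ^ n = 0 := by
  have h := norm_integral_mollify_mul_sub_le ρ hg hgc (F := fun z ↦ z ^ n) (by fun_prop)
    (A := 0) (η := 0) fun t _ ↦ by
      have := hp ((X + C t) ^ n)
      simp only [eval_pow, eval_add, eval_X, eval_C] at this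
      rw [this, sub_zero, norm_zero]
  rwa [sub_zero, norm_le_zero_iff] at h

/-- Integration against a fixed test function is continuous under mollification. -/
lemma exists_norm_integral_mollify_mul_sub_le {g F : ℂ → ℂ} (hg : Integrable g)
    (hgc : HasCompactSupport g) (hF : Continuous F) (hFc : HasCompactSupport F) {η : ℝ}
    (hη : 0 < η) : ∃ r > 0, ∀ ρ : ContDiffBump (0 : ℂ), ρ.rOut ≤ r →
      ‖(∫ z, mollify ρ g z * F z) - ∫ z, g z * F z‖ ≤ η := by
  set M := ∫ z, ‖g z‖ with hM
  have hM0 : 0 ≤ M := integral_nonneg fun z ↦ norm_nonneg _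
  have huc : UniformContinuous F := hFc.uniformContinuous_of_continuous hF
  obtain ⟨r, hr, h⟩ := Metric.uniformContinuous_iff.1 huc (η / (M + 1)) (by positivity)
  refine ⟨r, hr, fun ρ hρ ↦ norm_integral_mollify_mul_sub_le ρ hg hgc hF fun t ht ↦ ?_⟩
  have hi : ∀ t, Integrable fun y ↦ g y * F (y + t) := fun t ↦ by
    obtain ⟨B, hB⟩ := hF.bounded_above_of_compact_support hFc
    exact hg.mul_bdd (c := B) (by fun_prop) (ae_of_all _ fun y ↦ hB _)
  have hi0 : Integrable fun y ↦ g y * F y := by simpa using hi 0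
  rw [← integral_sub (hi t) hi0]
  calc ‖∫ y, (g y * F (y + t) - g y * F y)‖ ≤ ∫ y, ‖g y‖ * (η / (M + 1)) := by
        refine norm_integral_le_of_norm_le (hg.norm.mul_const _) (ae_of_all _ fun y ↦ ?_)
        rw [← mul_sub, norm_mul, ← dist_eq_norm]
        gcongr
        refine (h ?_).le
        rw [dist_eq_norm, add_sub_cancel_left]
        exact (mem_ball_zero_iff.1 ht).trans_le hρ
    _ = M * (η / (M + 1)) := integral_mul_const _ _
    _ ≤ η := by
        rw [mul_div_assoc', div_le_iff₀ (by positivity)]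
        nlinarith

lemma integrable_of_lintegral_enorm_sq {G : Set ℂ} (hGm : MeasurableSet G)
    (hGb : Bornology.IsBounded G) {g : ℂ → ℂ} (hg : Measurable g)
    (hg2 : ∫⁻ z, ‖g z‖ₑ ^ 2 < ⊤) (hg0 : ∀ z ∉ G, g z = 0) : Integrable g := by
  have hfin : volume G < ⊤ := hGb.measure_lt_top
  have hm : MemLp g 2 (volume.restrict G) := by
    refine ⟨hg.aestronglyMeasurable, ?_⟩
    rw [eLpNorm_lt_top_iff_lintegral_rpow_enorm_lt_top two_ne_zero ENNReal.ofNat_ne_top]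
    refine (setLIntegral_le_lintegral _ _).trans_lt ?_
    simpa using hg2
  have : IsFiniteMeasure (volume.restrict G) := ⟨by simpa using hfin⟩
  have hi : IntegrableOn g G := hm.integrable one_le_two
  rwa [← integrable_indicator_iff hGm, indicator_eq_self.2] at hi
  intro z hz
  by_contra h
  exact hz (hg0 z h)

/-- A function orthogonal to the polynomials is almost orthogonal to the truncations of a
holomorphic function. -/
lemma exists_cutoff_enorm_integral_sq_le {G : Set ℂ} (hGo : IsOpen G)
    (hGb : Bornology.IsBounded G) (hGc : IsPreconnected (closure G)ᶜ)
    (hGf : frontier G ⊆ closure (closure G)ᶜ) {f g : ℂ → ℂ} (hf : DifferentiableOn ℂ f G)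
    (hg : Measurable g) (hg2 : ∫⁻ z, ‖g z‖ₑ ^ 2 < ⊤) (hg0 : ∀ z ∉ G, g z = 0)
    (hp : ∀ p : ℂ[X], ∫ z, g z * p.eval z = 0) {δ : ℝ} (hδ : 0 < δ) :
    ∃ χ : ℂ → ℝ, Continuous χ ∧ (∀ z, ‖χ z‖ ≤ 1) ∧
      (∀ z, 4 * δ ≤ infDist z Gᶜ → χ z = 1) ∧
      ‖∫ z, g z * (f z * (χ z : ℂ))‖ₑ ^ 2 ≤ ENNReal.ofReal (640000 * Real.pi ^ 2) *
        (∫⁻ z, ‖g z‖ₑ ^ 2) * ∫⁻ z in {z | infDist z Gᶜ ∈ Icc δ (4 * δ)}, ‖f z‖ₑ ^ 2 := by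
  obtain ⟨χ, hχ, hχ1, -, hχo, hF, hFc, hdF0, hdF⟩ := exists_cutoff_mul hGo hGb hf hδ
  refine ⟨χ, hχ, hχ1, hχo, ?_⟩
  have hgi : Integrable g := integrable_of_lintegral_enorm_sq hGo.measurableSet hGb hg hg2 hg0
  have hgK : ∀ z ∉ closure G, g z = 0 := fun z hz ↦ hg0 z fun h ↦ hz (subset_closure h)
  have hgc : HasCompactSupport g := HasCompactSupport.intro hGb.isCompact_closure hgK
  obtain ⟨r₁, hr₁, hstrip⟩ := exists_lintegral_strip_cauchyTransform_le hGo hGb hGc hGf hδ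
  set S := {z | infDist z Gᶜ ∈ Icc δ (4 * δ)} with hS
  have hmoll : ∀ ρ : ContDiffBump (0 : ℂ), ρ.rOut ≤ r₁ →
      ‖∫ z, mollify ρ g z * (f z * (χ z : ℂ))‖ₑ ^ 2 ≤ ENNReal.ofReal (640000 * Real.pi ^ 2) *
        (∫⁻ z, ‖g z‖ₑ ^ 2) * ∫⁻ z in S, ‖f z‖ₑ ^ 2 := fun ρ hρ ↦ by
    have hφ : ContDiff ℝ 2 (mollify ρ g) := contDiff_mollify ρ hgi.locallyIntegrable 2
    have hsupp := tsupport_mollify_subset ρ hgK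
    have hφc : HasCompactSupport (mollify ρ g) := HasCompactSupport.of_support_subset_isCompact
      hGb.isCompact_closure.cthickening ((subset_tsupport _).trans hsupp)
    obtain ⟨hu, hle⟩ := hstrip (mollify ρ g) hφ (hsupp.trans (cthickening_mono hρ _))
      (integral_mollify_mul_pow_eq_zero ρ hgi hgc hp)
    refine (enorm_integral_mul_sq_le hφ hφc hu hF (S := S) fun z hz ↦ hdF0 z hz).trans ?_
    have hdF2 : ∫⁻ z in S, ‖dbar (fun z ↦ f z * (χ z : ℂ)) z‖ₑ ^ 2 ≤
        ENNReal.ofReal ((2 / δ) ^ 2) * ∫⁻ z in S, ‖f z‖ₑ ^ 2 := by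
      rw [← lintegral_const_mul' _ _ ENNReal.ofReal_ne_top]
      refine lintegral_mono fun z ↦ ?_
      dsimp only
      rw [ENNReal.ofReal_pow (by positivity), ← mul_pow]
      gcongr
      rw [← ofReal_norm, ← ofReal_norm, ← ENNReal.ofReal_mul (by positivity)]
      exact ENNReal.ofReal_le_ofReal (hdF z)
    calc _ ≤ (ENNReal.ofReal (160000 * Real.pi ^ 2 * δ ^ 2) * ∫⁻ z, ‖g z‖ₑ ^ 2) *
          (ENNReal.ofReal ((2 / δ) ^ 2) * ∫⁻ z in S, ‖f z‖ₑ ^ 2) :=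
        mul_le_mul' (hle.trans (mul_le_mul_right (lintegral_enorm_mollify_sq_le ρ hg) _)) hdF2
      _ = (ENNReal.ofReal (160000 * Real.pi ^ 2 * δ ^ 2) * ENNReal.ofReal ((2 / δ) ^ 2)) *
          (∫⁻ z, ‖g z‖ₑ ^ 2) * ∫⁻ z in S, ‖f z‖ₑ ^ 2 := by ring
      _ = _ := by
        rw [← ENNReal.ofReal_mul (by positivity)]
        congr 3
        field_simp
        norm_num
  set A := ∫ z, g z * (f z * (χ z : ℂ)) with hA
  have hcl : IsClosed {x : ℂ | ‖x‖ₑ ^ 2 ≤ ENNReal.ofReal (640000 * Real.pi ^ 2) *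
      (∫⁻ z, ‖g z‖ₑ ^ 2) * ∫⁻ z in S, ‖f z‖ₑ ^ 2} :=
    isClosed_le ((ENNReal.continuous_pow 2).comp continuous_enorm) continuous_const
  refine hcl.closure_subset (Metric.mem_closure_iff.2 fun η hη ↦ ?_)
  obtain ⟨r₂, hr₂, happ⟩ := exists_norm_integral_mollify_mul_sub_le hgi hgc hF.continuous hFc
    (half_pos hη)
  have hr : 0 < min r₁ r₂ := lt_min hr₁ hr₂
  let ρ : ContDiffBump (0 : ℂ) := ⟨min r₁ r₂ / 2, min r₁ r₂, by linarith, by linarith⟩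
  refine ⟨_, hmoll ρ (min_le_left _ _), ?_⟩
  rw [dist_comm, dist_eq_norm]
  exact (happ ρ (min_le_right _ _)).trans_lt (half_lt_self hη)

/-- A square-integrable function on `G` that is orthogonal to the polynomials is orthogonal to
every square-integrable holomorphic function. -/
lemma integral_mul_eq_zero_of_forall_polynomial {G : Set ℂ} (hGo : IsOpen G)
    (hGb : Bornology.IsBounded G) (hGc : IsPreconnected (closure G)ᶜ)
    (hGf : frontier G ⊆ closure (closure G)ᶜ) {f g : ℂ → ℂ} (hf : DifferentiableOn ℂ f G)
    (hf2 : ∫⁻ z in G, ‖f z‖ₑ ^ 2 < ⊤)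
    (hg : Measurable g) (hg2 : ∫⁻ z, ‖g z‖ₑ ^ 2 < ⊤) (hg0 : ∀ z ∉ G, g z = 0)
    (hp : ∀ p : ℂ[X], ∫ z, g z * p.eval z = 0) : ∫ z in G, g z * f z = 0 := by
  have hδ : ∀ n : ℕ, (0 : ℝ) < 1 / (n + 1) := fun n ↦ Nat.one_div_pos_of_nat
  choose χ hχ hχ1 hχo hle using fun n : ℕ ↦
    exists_cutoff_enorm_integral_sq_le hGo hGb hGc hGf hf hg hg2 hg0 hp (hδ n)
  have hδ0 : Tendsto (fun n : ℕ ↦ 4 * ((1 : ℝ) / (n + 1))) atTop (nhds 0) := by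
    simpa using tendsto_one_div_add_atTop_nhds_zero_nat.const_mul (4 : ℝ)
  have hne : Gᶜ.Nonempty := by
    by_contra h
    rw [not_nonempty_iff_eq_empty, compl_empty_iff] at h
    exact NormedSpace.unbounded_univ ℝ ℂ (h ▸ hGb)
  have hpos : ∀ z ∈ G, 0 < infDist z Gᶜ := fun z hz ↦
    (hGo.isClosed_compl.notMem_iff_infDist_pos hne).1 fun h ↦ h hz
  have hev : ∀ z ∈ G, ∀ᶠ n : ℕ in atTop, 4 * ((1 : ℝ) / (n + 1)) < infDist z Gᶜ :=
    fun z hz ↦ hδ0.eventually_lt_const (hpos z hz)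
  have hfm : AEStronglyMeasurable f (volume.restrict G) :=
    hf.continuousOn.aestronglyMeasurable hGo.measurableSet
  have hgf : Integrable (fun z ↦ g z * f z) (volume.restrict G) := by
    refine ⟨hg.aestronglyMeasurable.mul hfm, ?_⟩
    rw [hasFiniteIntegral_iff_enorm]
    have h := sq_lintegral_mul_le (volume.restrict G) (f := fun z ↦ ‖g z‖ₑ) (g := fun z ↦ ‖f z‖ₑ)
      hg.enorm.aemeasurable hfm.enorm
    have h2 : (∫⁻ z in G, ‖g z‖ₑ ^ 2) * ∫⁻ z in G, ‖f z‖ₑ ^ 2 < ⊤ :=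
      ENNReal.mul_lt_top ((setLIntegral_le_lintegral _ _).trans_lt hg2) hf2
    simp only [enorm_mul]
    by_contra htop
    rw [not_lt_top_iff] at htop
    rw [htop] at h
    exact absurd (h.trans_lt h2) (by simp)
  have hlim : Tendsto (fun n ↦ ∫ z in G, g z * (f z * (χ n z : ℂ))) atTop
      (nhds (∫ z in G, g z * f z)) := by
    refine tendsto_integral_of_dominated_convergence (fun z ↦ ‖g z * f z‖) (fun n ↦ ?_) hgf.norm
      (fun n ↦ ae_of_all _ fun z ↦ ?_) ?_
    · exact hg.aestronglyMeasurable.mul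
        (hfm.mul (Complex.continuous_ofReal.comp (hχ n)).aestronglyMeasurable)
    · rw [← mul_assoc, norm_mul, Complex.norm_real]
      exact mul_le_of_le_one_right (norm_nonneg _) (hχ1 n z)
    · refine ae_restrict_of_forall_mem hGo.measurableSet fun z hz ↦ ?_
      refine tendsto_const_nhds.congr' ?_
      filter_upwards [hev z hz] with n hn
      rw [hχo n z hn.le, Complex.ofReal_one, mul_one]
  have hstrip : Tendsto (fun n : ℕ ↦ ∫⁻ z in {z | infDist z Gᶜ ∈ Icc ((1 : ℝ) / (n + 1))
      (4 * (1 / (n + 1)))}, ‖f z‖ₑ ^ 2) atTop (nhds 0) := by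
    have hSm : ∀ n : ℕ, MeasurableSet {z | infDist z Gᶜ ∈ Icc ((1 : ℝ) / (n + 1))
        (4 * (1 / (n + 1)))} := fun n ↦
      (isClosed_Icc.preimage (continuous_infDist_pt Gᶜ)).measurableSet
    have hSG : ∀ n : ℕ, {z | infDist z Gᶜ ∈ Icc ((1 : ℝ) / (n + 1)) (4 * (1 / (n + 1)))} ⊆ G :=
      fun n z hz ↦ by
        by_contra h
        have h1 : (1 : ℝ) / (n + 1) ≤ infDist z Gᶜ := hz.1
        rw [infDist_zero_of_mem (s := Gᶜ) h] at h1
        exact (hδ n).not_ge h1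
    have h : Tendsto (fun n : ℕ ↦ ∫⁻ z in G, {z | infDist z Gᶜ ∈ Icc ((1 : ℝ) / (n + 1))
        (4 * (1 / (n + 1)))}.indicator (fun z ↦ ‖f z‖ₑ ^ 2) z) atTop (nhds (∫⁻ z in G, 0)) := by
      refine tendsto_lintegral_of_dominated_convergence' (fun z ↦ ‖f z‖ₑ ^ 2) (fun n ↦ ?_)
        (fun n ↦ ae_of_all _ fun z ↦ indicator_le_self _ _ z) hf2.ne ?_
      · exact (hfm.enorm.pow_const 2).indicator (hSm n)
      · refine ae_restrict_of_forall_mem hGo.measurableSet fun z hz ↦ ?_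
        refine tendsto_const_nhds.congr' ?_
        filter_upwards [hev z hz] with n hn
        exact (indicator_of_notMem (fun h ↦ h.2.not_gt hn) _).symm
    rw [lintegral_zero] at h
    refine h.congr fun n ↦ ?_
    rw [lintegral_indicator (hSm n), Measure.restrict_restrict (hSm n),
      inter_eq_left.2 (hSG n)]
  have hset : ∀ n, ∫ z in G, g z * (f z * (χ n z : ℂ)) = ∫ z, g z * (f z * (χ n z : ℂ)) :=
    fun n ↦ setIntegral_eq_integral_of_forall_compl_eq_zero fun z hz ↦ by rw [hg0 z hz, zero_mul]
  have hzero : Tendsto (fun n ↦ ‖∫ z in G, g z * (f z * (χ n z : ℂ))‖ₑ ^ 2) atTop (nhds 0) := by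
    have hC : ENNReal.ofReal (640000 * Real.pi ^ 2) * (∫⁻ z, ‖g z‖ₑ ^ 2) ≠ ⊤ :=
      ENNReal.mul_ne_top ENNReal.ofReal_ne_top hg2.ne
    have h := ENNReal.Tendsto.const_mul hstrip (Or.inr hC)
    rw [mul_zero] at h
    refine tendsto_of_tendsto_of_tendsto_of_le_of_le tendsto_const_nhds h (fun n ↦ zero_le)
      fun n ↦ ?_
    dsimp only
    rw [hset n]
    exact hle n
  have hfinal := tendsto_nhds_unique
    (((ENNReal.continuous_pow 2).comp continuous_enorm).continuousAt.tendsto.comp hlim) hzero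
  simpa using hfinal

/-! ### Density of the polynomials -/

lemma memLp_eval {G : Set ℂ} (hGb : Bornology.IsBounded G) (p : ℂ[X]) :
    MemLp (fun z ↦ p.eval z) 2 (volume.restrict G) := by
  have hc : Continuous fun z : ℂ ↦ p.eval z := p.continuous
  obtain ⟨B, hB⟩ := hGb.isCompact_closure.exists_bound_of_continuousOn hc.continuousOn
  have : IsFiniteMeasure (volume.restrict G) := ⟨by simpa using hGb.measure_lt_top⟩
  have : IsFiniteMeasure (volume.restrict (closure G)) :=
    ⟨by simpa using hGb.isCompact_closure.measure_lt_top⟩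
  exact (MemLp.of_bound hc.aestronglyMeasurable B
    (ae_restrict_of_forall_mem isClosed_closure.measurableSet hB)).mono_measure
    (Measure.restrict_mono_set _ subset_closure)

lemma memLp_two_iff_lintegral_enorm_sq {μ : Measure ℂ} {f : ℂ → ℂ}
    (hf : AEStronglyMeasurable f μ) : MemLp f 2 μ ↔ ∫⁻ z, ‖f z‖ₑ ^ 2 ∂μ < ⊤ := by
  rw [MemLp, and_iff_right hf,
    eLpNorm_lt_top_iff_lintegral_rpow_enorm_lt_top two_ne_zero ENNReal.ofNat_ne_top]
  simp

/-- The polynomials as elements of `L²(G)`. -/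
def polynomialToLp {G : Set ℂ} (hGb : Bornology.IsBounded G) :
    ℂ[X] →ₗ[ℂ] Lp ℂ 2 (volume.restrict G) where
  toFun p := (memLp_eval hGb p).toLp _
  map_add' p q := by
    rw [← MemLp.toLp_add]
    simp only [eval_add]
    rfl
  map_smul' c p := by
    rw [RingHom.id_apply, ← MemLp.toLp_const_smul]
    simp only [eval_smul]
    rfl

/-- Polynomials are dense in the Bergman space of a bounded open set whose closure does not
separate the plane and whose boundary is accessible from the complement of its closure. -/
theorem exists_polynomial_lintegral_lt {G : Set ℂ} (hGo : IsOpen G)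
    (hGb : Bornology.IsBounded G) (hGc : IsPreconnected (closure G)ᶜ)
    (hGf : frontier G ⊆ closure (closure G)ᶜ) {f : ℂ → ℂ} (hf : DifferentiableOn ℂ f G)
    (hf2 : ∫⁻ z in G, ‖f z‖ₑ ^ 2 < ⊤) {ε : ℝ} (hε : 0 < ε) :
    ∃ p : ℂ[X], ∫⁻ z in G, ‖f z - p.eval z‖ₑ ^ 2 < ENNReal.ofReal ε := by
  have hfm : MemLp f 2 (volume.restrict G) := (memLp_two_iff_lintegral_enorm_sq
    (hf.continuousOn.aestronglyMeasurable hGo.measurableSet)).2 hf2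
  have hmem : hfm.toLp f ∈ (polynomialToLp hGb).range.topologicalClosure := by
    rw [← Submodule.orthogonal_orthogonal_eq_closure, Submodule.mem_orthogonal]
    intro h hh
    rw [Submodule.mem_orthogonal'] at hh
    set g : ℂ → ℂ := G.indicator fun z ↦ starRingEnd ℂ (h z) with hg
    have hgm : Measurable g :=
      (Complex.continuous_conj.measurable.comp (Lp.stronglyMeasurable h).measurable).indicator
        hGo.measurableSet
    have hgG : ∀ z ∈ G, g z = starRingEnd ℂ (h z) := fun z hz ↦ indicator_of_mem hz _
    have hg0 : ∀ z ∉ G, g z = 0 := fun z hz ↦ indicator_of_notMem hz _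
    have hg2 : ∫⁻ z, ‖g z‖ₑ ^ 2 < ⊤ := by
      have h2 := (memLp_two_iff_lintegral_enorm_sq (Lp.memLp h).1).1 (Lp.memLp h)
      rw [← lintegral_indicator hGo.measurableSet] at h2
      refine lt_of_le_of_lt (lintegral_mono fun z ↦ ?_) h2
      by_cases hz : z ∈ G
      · rw [hgG z hz, indicator_of_mem hz, RCLike.enorm_conj]
      · simp [hg0 z hz]
    have hinner : ∀ {v : ℂ → ℂ} (hv : MemLp v 2 (volume.restrict G)),
        inner ℂ h (hv.toLp v) = ∫ z in G, g z * v z := fun {v} hv ↦ by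
      rw [L2.inner_def]
      refine integral_congr_ae ?_
      filter_upwards [hv.coeFn_toLp, ae_restrict_mem hGo.measurableSet] with z hz hzG
      rw [hz, hgG z hzG, RCLike.inner_apply, mul_comm]
    rw [hinner hfm]
    refine integral_mul_eq_zero_of_forall_polynomial hGo hGb hGc hGf hf hf2 hgm hg2 hg0 fun p ↦ ?_
    rw [← setIntegral_eq_integral_of_forall_compl_eq_zero (s := G) fun z hz ↦ by
      rw [hg0 z hz, zero_mul], ← hinner (memLp_eval hGb p)]
    exact hh _ ⟨p, rfl⟩
  obtain ⟨_, ⟨p, rfl⟩, hp⟩ := Metric.mem_closure_iff.1 hmem (Real.sqrt ε) (Real.sqrt_pos.2 hε)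
  refine ⟨p, ?_⟩
  have hd : eLpNorm (fun z ↦ f z - p.eval z) 2 (volume.restrict G) <
      ENNReal.ofReal (Real.sqrt ε) := by
    rw [← edist_lt_ofReal] at hp
    exact (Lp.edist_toLp_toLp f _ hfm (memLp_eval hGb p)).symm.trans_lt hp
  have h2 := eLpNorm_nnreal_pow_eq_lintegral (μ := volume.restrict G)
    (f := fun z ↦ f z - p.eval z) (p := 2) two_ne_zero
  simp only [NNReal.coe_ofNat, ENNReal.rpow_ofNat, ENNReal.coe_ofNat] at h2
  rw [← h2]
  calc _ < ENNReal.ofReal (Real.sqrt ε) ^ 2 := ENNReal.pow_lt_pow_left two_ne_zero hd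
    _ = ENNReal.ofReal ε := by rw [← ENNReal.ofReal_pow (Real.sqrt_nonneg _), Real.sq_sqrt hε.le]

/-- Polynomials are dense in the Bergman space of the archipelago `G`. -/
theorem stmt5 (N : ℕ) (hN : 1 ≤ N) (Gs : Fin N → Set ℂ) (hArch : IsArchipelago Gs) :
    ∀ f : ℂ → ℂ, DifferentiableOn ℂ f (⋃ j, Gs j) →
      (∫⁻ z in (⋃ j, Gs j), (‖f z‖₊ : ENNReal) ^ 2) < ⊤ →
      ∀ ε : ℝ, 0 < ε → ∃ p : Polynomial ℂ,
        (∫⁻ z in (⋃ j, Gs j), (‖f z - p.eval z‖₊ : ENNReal) ^ 2) <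
          ENNReal.ofReal ε := by
  intro f hf hf2 ε hε
  obtain ⟨hGo, hGb, hGc, hGf⟩ := hArch.topology
  exact exists_polynomial_lintegral_lt hGo hGb hGc hGf hf hf2 hε
end
end

section
/- The sup-norms of the Bergman orthonormal polynomials of G on the closure of G have n-th root limit one: lim_{n → ∞} ( sup_{z ∈ closure(G)} |P_n(z)| )^{1/n} = 1. -/
open MeasureTheory Filter Polynomial Set Metric

noncomputable section

/-- Lagrange interpolation of the Chebyshev polynomial at its extremal points; for `1 ≤ x` all terms
of the sum are nonnegative. -/
theorem sum_prod_abs_node_eq_eval_T (n : ℕ) (x : ℝ) :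
    ∑ i ∈ Finset.range (n + 1), ∏ j ∈ (Finset.range (n + 1)).erase i,
      (x - Chebyshev.node n j) / |Chebyshev.node n i - Chebyshev.node n j| =
    (Chebyshev.T ℝ n).eval x := by
  have hdeg : (Chebyshev.T ℝ n).degree < (Finset.range (n + 1)).card := by
    rw [Finset.card_range, Chebyshev.degree_T]
    simp only [Int.natAbs_natCast]
    exact_mod_cast Nat.lt_succ_self n
  conv_rhs =>
    rw [Lagrange.eq_interpolate (Chebyshev.strictAntiOn_node n).injOn hdeg,
      Lagrange.interpolate_eq_sum]
  rw [eval_finsetSum]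
  refine Finset.sum_congr rfl fun i hi => ?_
  have hi' : i ≤ n := Finset.mem_range_succ_iff.1 hi
  have hpos := Chebyshev.zero_lt_prod_node_sub_node hi'
  rw [Finset.prod_div_distrib, ← Finset.abs_prod, eval_mul, eval_C, eval_prod,
    Chebyshev.eval_T_real_node (Finset.mem_Iic.2 hi')]
  simp only [eval_sub, eval_X, eval_C]
  have habs : |∏ j ∈ (Finset.range (n + 1)).erase i,
      (Chebyshev.node n i - Chebyshev.node n j)| =
      (-1) ^ i * ∏ j ∈ (Finset.range (n + 1)).erase i,
        (Chebyshev.node n i - Chebyshev.node n j) := by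
    rw [← abs_of_pos hpos, abs_mul, abs_neg_one_pow, one_mul]
  rw [habs]
  rcases neg_one_pow_eq_or ℝ i with h | h <;> rw [h] <;> ring

/-- A Bernstein–Walsh type estimate: a polynomial bounded by `M` on a connected set `E` grows slowly
near a point of `E`. -/
theorem norm_eval_le_of_isPreconnected {E : Set ℂ} (hE : IsPreconnected E) {w u : ℂ} (hw : w ∈ E)
    (hu : u ∈ E) {r : ℝ} (hr : 0 < r) (hwu : 2 * r ≤ ‖u - w‖) {n : ℕ} {p : ℂ[X]}
    (hp : p.natDegree ≤ n) {M : ℝ} (hM : ∀ z ∈ E, ‖p.eval z‖ ≤ M) {θ : ℝ} (hθ : 0 ≤ θ) {z : ℂ}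
    (hz : ‖z - w‖ ≤ r * (Real.cosh θ - 1)) :
    ‖p.eval z‖ ≤ M * Real.exp (n * θ) := by
  have hM0 : 0 ≤ M := (norm_nonneg _).trans (hM w hw)
  have hnode : ∀ i, ∃ v ∈ E, ‖v - w‖ = r * (1 - Chebyshev.node n i) := by
    intro i
    have hi := Chebyshev.node_mem_Icc (n := n) (i := i)
    have hsub := hE.intermediate_value hw hu (f := fun v => ‖v - w‖) (by fun_prop)
    obtain ⟨v, hv, hv'⟩ := hsub (show r * (1 - Chebyshev.node n i) ∈ _ from
      ⟨by simpa using mul_nonneg hr.le (by linarith [hi.2]), by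
        nlinarith [hi.1]⟩)
    exact ⟨v, hv, hv'⟩
  choose v hvE hv using hnode
  have hdist : ∀ i j, r * |Chebyshev.node n i - Chebyshev.node n j| ≤ ‖v i - v j‖ := by
    intro i j
    have h := abs_norm_sub_norm_le (v i - w) (v j - w)
    rw [hv, hv, sub_sub_sub_cancel_right, ← mul_sub, abs_mul, abs_of_pos hr,
      sub_sub_sub_cancel_left, abs_sub_comm] at h
    exact h
  have hne : ∀ i ∈ Finset.range (n + 1), ∀ j ∈ Finset.range (n + 1), i ≠ j →
      0 < |Chebyshev.node n i - Chebyshev.node n j| := fun i hi j hj hij =>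
    abs_pos.2 (sub_ne_zero.2 ((Chebyshev.strictAntiOn_node n).injOn.ne
      (Finset.mem_coe.2 hi) (Finset.mem_coe.2 hj) hij))
  have hinj : Set.InjOn v (Finset.range (n + 1)) := by
    intro i hi j hj hij
    by_contra h
    have h1 := mul_pos hr (hne i hi j hj h)
    have h2 := hdist i j
    rw [hij, sub_self, norm_zero] at h2
    exact absurd h1 h2.not_gt
  have hdeg : p.degree < (Finset.range (n + 1)).card := by
    rw [Finset.card_range]
    exact (natDegree_le_iff_degree_le.1 hp).trans_lt (by exact_mod_cast Nat.lt_succ_self n)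
  have hfac : ∀ j, ‖z - v j‖ ≤ r * (Real.cosh θ - Chebyshev.node n j) := by
    intro j
    calc ‖z - v j‖ ≤ ‖z - w‖ + ‖v j - w‖ := by
          rw [← sub_sub_sub_cancel_right z (v j) w]; exact norm_sub_le _ _
      _ ≤ r * (Real.cosh θ - Chebyshev.node n j) := by rw [hv]; linarith
  calc ‖p.eval z‖
      = ‖∑ i ∈ Finset.range (n + 1), p.eval (v i) *
          ∏ j ∈ (Finset.range (n + 1)).erase i, (z - v j) / (v i - v j)‖ := by
        conv_lhs => rw [Lagrange.eq_interpolate hinj hdeg, Lagrange.interpolate_eq_sum]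
        rw [eval_finsetSum]
        congr 1
        refine Finset.sum_congr rfl fun i hi => ?_
        rw [Finset.prod_div_distrib, eval_mul, eval_C, eval_prod]
        simp only [eval_sub, eval_X, eval_C]
        ring
    _ ≤ ∑ i ∈ Finset.range (n + 1), M * ∏ j ∈ (Finset.range (n + 1)).erase i,
          (Real.cosh θ - Chebyshev.node n j) /
            |Chebyshev.node n i - Chebyshev.node n j| := by
        refine norm_sum_le_of_le _ fun i hi => ?_
        rw [norm_mul, norm_prod]
        refine mul_le_mul (hM _ (hvE i)) (Finset.prod_le_prod (fun _ _ => norm_nonneg _) ?_)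
          (Finset.prod_nonneg fun _ _ => norm_nonneg _) hM0
        intro j hj
        obtain ⟨hji, hj'⟩ := Finset.mem_erase.1 hj
        have hpos := hne i hi j hj' hji.symm
        rw [norm_div, ← mul_div_mul_left (Real.cosh θ - _) _ hr.ne']
        exact div_le_div₀ ((norm_nonneg _).trans (hfac j)) (hfac j) (mul_pos hr hpos) (hdist i j)
    _ = M * Real.cosh (n * θ) := by
        rw [← Finset.mul_sum, sum_prod_abs_node_eq_eval_T, Chebyshev.T_real_cosh, Int.cast_natCast]
    _ ≤ M * Real.exp (n * θ) := by
        gcongr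
        rw [Real.cosh_eq]
        have : Real.exp (-(n * θ)) ≤ Real.exp (n * θ) :=
          Real.exp_le_exp.2 (neg_le_self (by positivity))
        linarith

/-- Nonconstant monomials have vanishing integral over discs centred at the origin. -/
theorem setIntegral_ball_pow (ρ : ℝ) {k : ℕ} (hk : k ≠ 0) :
    ∫ z in ball (0 : ℂ) ρ, z ^ k = 0 := by
  set c : Circle := Circle.exp (Real.pi / k)
  have hc : (c : ℂ) ^ k = -1 := by
    rw [Circle.coe_exp, ← Complex.exp_nat_mul]
    convert Complex.exp_pi_mul_I using 2
    push_cast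
    field_simp
  have hpre : rotation c ⁻¹' ball (0 : ℂ) ρ = ball 0 ρ := by
    ext z; simp [Circle.norm_coe, -LinearIsometryEquiv.preimage_ball]
  have h := (rotation c).measurePreserving.setIntegral_preimage_emb
    (rotation c).toHomeomorph.measurableEmbedding (fun z : ℂ => z ^ k) (ball 0 ρ)
  rw [hpre] at h
  simp only [rotation_apply, mul_pow, hc, neg_mul, one_mul, integral_neg] at h
  exact self_eq_neg.1 h.symm

/-- The mean value property over discs, for polynomials. -/
theorem setIntegral_ball_eval (p : ℂ[X]) (z : ℂ) (ρ : ℝ) :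
    ∫ w in ball z ρ, p.eval w = volume.real (ball z ρ) * p.eval z := by
  have htrans : ∫ w in ball z ρ, p.eval w = ∫ w in ball (0 : ℂ) ρ, (p.comp (X + C z)).eval w := by
    have h := (measurePreserving_add_right volume z).setIntegral_preimage_emb
      (measurableEmbedding_addRight z) (fun w : ℂ => p.eval w) (ball z ρ)
    rw [← h]
    simp [eval_comp]
  have hvol : volume.real (ball z ρ) = volume.real (ball (0 : ℂ) ρ) := by
    simp [measureReal_def, Complex.volume_ball]
  have hz : p.eval z = (p.comp (X + C z)).coeff 0 := by simp [coeff_zero_eq_eval_zero, eval_comp]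
  rw [htrans, hvol, hz]
  generalize p.comp (X + C z) = q
  simp only [eval_eq_sum_range]
  rw [integral_finsetSum, Finset.sum_range_succ', Finset.sum_eq_zero]
  · simp [measureReal_def]
  · intro k _
    rw [integral_const_mul, setIntegral_ball_pow ρ k.succ_ne_zero, mul_zero]
  · intro k _
    have hcont : Continuous fun w : ℂ => q.coeff k * w ^ k := by fun_prop
    exact (hcont.continuousOn.integrableOn_compact (isCompact_closedBall 0 ρ)).mono_set ball_subset_closedBall

theorem integrableOn_norm_eval_sq (p : ℂ[X]) {G : Set ℂ} (hG : Bornology.IsBounded G) :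
    IntegrableOn (fun w => ‖p.eval w‖ ^ 2) G :=
  ((by fun_prop : Continuous fun w : ℂ => ‖p.eval w‖ ^ 2).continuousOn.integrableOn_compact
    hG.isCompact_closure).mono_set subset_closure

/-- Point evaluations of polynomials are controlled by the `L²` norm over a surrounding disc. -/
theorem norm_eval_sq_le_of_ball_subset (p : ℂ[X]) {G : Set ℂ} (hG : Bornology.IsBounded G) {z : ℂ}
    {ρ : ℝ} (hball : ball z ρ ⊆ G) :
    volume.real (ball (0 : ℂ) ρ) * ‖p.eval z‖ ^ 2 ≤ ∫ w in G, ‖p.eval w‖ ^ 2 := by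
  have hvol : volume.real (ball (0 : ℂ) ρ) = volume.real (ball z ρ) := by
    simp [measureReal_def, Complex.volume_ball]
  calc volume.real (ball (0 : ℂ) ρ) * ‖p.eval z‖ ^ 2
      = ‖∫ w in ball z ρ, (p ^ 2).eval w‖ := by
        rw [setIntegral_ball_eval, hvol]
        simp [abs_of_nonneg measureReal_nonneg]
    _ ≤ ∫ w in ball z ρ, ‖(p ^ 2).eval w‖ := norm_integral_le_integral_norm _
    _ = ∫ w in ball z ρ, ‖p.eval w‖ ^ 2 := by simp
    _ ≤ ∫ w in G, ‖p.eval w‖ ^ 2 :=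
        setIntegral_mono_set (integrableOn_norm_eval_sq p hG)
          (Eventually.of_forall fun _ => by positivity) hball.eventuallyLE

/-- A finite subset of a connected open set lies in a connected compact subset. -/
theorem IsOpen.exists_isCompact_isPreconnected_superset {G : Set ℂ} (hG : IsOpen G)
    (hconn : IsConnected G) (t : Finset ℂ) (ht : ↑t ⊆ G) (hne : t.Nonempty) :
    ∃ K ⊆ G, IsCompact K ∧ IsPreconnected K ∧ ↑t ⊆ K := by
  obtain ⟨m, hm⟩ : ∃ m, t.card = m + 1 := Nat.exists_eq_succ_of_ne_zero hne.card_pos.ne'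
  let e := t.equivFinOfCardEq hm
  obtain ⟨γ, hγ, hmem⟩ := (hG.isConnected_iff_isPathConnected.1 hconn).exists_path_through_family
    (fun i => (e.symm i : ℂ)) fun i => ht (e.symm i).2
  refine ⟨range γ, hγ, isCompact_range γ.continuous, isPreconnected_range γ.continuous, ?_⟩
  intro z hz
  simpa using hmem (e ⟨z, hz⟩)

/-- On the closure of a bounded domain, the sup norm of polynomials exceeds the `L²` norm by a
factor of subexponential growth in the degree. -/
theorem exists_norm_eval_sq_le_of_isConnected {G : Set ℂ} (hG : IsOpen G) (hconn : IsConnected G)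
    (hbdd : Bornology.IsBounded G) {θ : ℝ} (hθ : 0 < θ) :
    ∃ A > 0, ∀ (n : ℕ) (p : ℂ[X]), p.natDegree ≤ n → ∀ z ∈ closure G,
      ‖p.eval z‖ ^ 2 ≤ A * (∫ w in G, ‖p.eval w‖ ^ 2) * Real.exp (n * θ) ^ 2 := by
  obtain ⟨z₀, hz₀⟩ := hconn.nonempty
  obtain ⟨d, hd, hball⟩ := Metric.isOpen_iff.1 hG z₀ hz₀
  have hz₁ : z₀ + (d / 2 : ℝ) ∈ G := hball (by
    rw [mem_ball, dist_eq_norm, add_sub_cancel_left, Complex.norm_real, Real.norm_of_nonneg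
      (by positivity)]
    linarith)
  set z₁ : ℂ := z₀ + (d / 2 : ℝ)
  have hdist : ‖z₁ - z₀‖ = d / 2 := by
    rw [add_sub_cancel_left, Complex.norm_real, Real.norm_of_nonneg (by positivity)]
  set δ : ℝ := d / 8 * (Real.cosh θ - 1)
  have hδ : 0 < δ := mul_pos (by positivity) (sub_pos.2 (Real.one_lt_cosh.2 hθ.ne'))
  obtain ⟨t, htG, hcover⟩ : ∃ t : Finset ℂ, ↑t ⊆ G ∧ ∀ z ∈ closure G, ∃ w ∈ t, ‖z - w‖ ≤ δ := by
    obtain ⟨t, htG, htfin, hcov⟩ := finite_approx_of_totallyBounded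
      (hbdd.isCompact_closure.totallyBounded.subset subset_closure) δ hδ
    have hclosed : IsClosed (⋃ y ∈ t, closedBall y δ) :=
      htfin.isClosed_biUnion fun y _ => isClosed_closedBall
    refine ⟨htfin.toFinset, by simpa using htG, fun z hz => ?_⟩
    have hmem := closure_minimal
      (hcov.trans (iUnion₂_mono fun y _ => ball_subset_closedBall)) hclosed hz
    simpa [dist_eq_norm] using hmem
  obtain ⟨K, hKG, hK, hKconn, htK⟩ := hG.exists_isCompact_isPreconnected_superset hconn
    (insert z₀ (insert z₁ t)) (by
      simp only [Finset.coe_insert]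
      exact insert_subset hz₀ (insert_subset hz₁ htG)) (Finset.insert_nonempty _ _)
  simp only [Finset.coe_insert, insert_subset_iff] at htK
  obtain ⟨hz₀K, hz₁K, htK⟩ := htK
  obtain ⟨ρ, hρ, hρG⟩ := hK.exists_thickening_subset_open hG hKG
  have hvol : 0 < volume.real (ball (0 : ℂ) ρ) := ENNReal.toReal_pos
    (measure_ball_pos _ _ hρ).ne' measure_ball_lt_top.ne
  refine ⟨(volume.real (ball (0 : ℂ) ρ))⁻¹, inv_pos.2 hvol, fun n p hp z hz => ?_⟩
  obtain ⟨w, hwt, hzw⟩ := hcover z hz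
  have hI : 0 ≤ ∫ w in G, ‖p.eval w‖ ^ 2 := integral_nonneg fun _ => by positivity
  have hB : 0 ≤ (volume.real (ball (0 : ℂ) ρ))⁻¹ * ∫ w in G, ‖p.eval w‖ ^ 2 := by positivity
  have hM : ∀ ζ ∈ K, ‖p.eval ζ‖ ≤
      √((volume.real (ball (0 : ℂ) ρ))⁻¹ * ∫ w in G, ‖p.eval w‖ ^ 2) := by
    intro ζ hζ
    refine Real.le_sqrt_of_sq_le ?_
    rw [le_inv_mul_iff₀ hvol]
    exact norm_eval_sq_le_of_ball_subset p hbdd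
      ((ball_subset_thickening hζ ρ).trans hρG)
  obtain ⟨u, huK, hu⟩ : ∃ u ∈ K, 2 * (d / 8) ≤ ‖u - w‖ := by
    by_contra! h
    have h0 := h z₀ hz₀K
    have h1 := h z₁ hz₁K
    have h2 := norm_sub_le (z₁ - w) (z₀ - w)
    rw [sub_sub_sub_cancel_right, hdist] at h2
    linarith
  have hfin := norm_eval_le_of_isPreconnected hKconn (htK hwt) huK (by positivity) hu hp hM hθ.le hzw
  calc ‖p.eval z‖ ^ 2 ≤ _ := pow_le_pow_left₀ (norm_nonneg _) hfin 2
    _ = _ := by rw [mul_pow, Real.sq_sqrt hB]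

theorem IsJordanDomain.isBounded {D : Set ℂ} (hD : IsJordanDomain D) : Bornology.IsBounded D := by
  obtain ⟨C, -, h, -⟩ := hD
  exact h

theorem IsJordanDomain.isConnected {D : Set ℂ} (hD : IsJordanDomain D) : IsConnected D := by
  obtain ⟨C, -, -, z, hz, rfl⟩ := hD
  exact isConnected_connectedComponentIn_iff.2 hz

theorem IsJordanDomain.isOpen {D : Set ℂ} (hD : IsJordanDomain D) : IsOpen D := by
  obtain ⟨C, ⟨f, hf, -, rfl⟩, -, z, -, rfl⟩ := hD
  exact ((isCompact_sphere 0 1).image_of_continuousOn hf).isClosed.isOpen_compl.connectedComponentIn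

/-- A positive sequence bounded below whose growth is subexponential has `n`-th root limit one. -/
theorem tendsto_rpow_one_div_one {S : ℕ → ℝ} {c : ℝ} (hc : 0 < c) (hlow : ∀ n, c ≤ S n)
    (hup : ∀ θ > 0, ∃ A > 0, ∀ n : ℕ, S n ≤ A * Real.exp (n * θ)) :
    Tendsto (fun n : ℕ => S n ^ ((1 : ℝ) / (n : ℝ))) atTop (nhds 1) := by
  have hroot : ∀ a : ℝ, 0 < a → Tendsto (fun n : ℕ => a ^ ((1 : ℝ) / (n : ℝ))) atTop (nhds 1) := by
    intro a ha
    have h := ((Real.continuous_const_rpow ha.ne').tendsto 0).comp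
      (tendsto_one_div_atTop_nhds_zero_nat (𝕜 := ℝ))
    rwa [Real.rpow_zero] at h
  rw [tendsto_order]
  constructor
  · intro a ha
    filter_upwards [(hroot c hc).eventually_const_lt ha] with n hn
    exact hn.trans_le (Real.rpow_le_rpow hc.le (hlow n) (by positivity))
  · intro a ha
    have hlog : 0 < Real.log a := Real.log_pos ha
    obtain ⟨A, hA, hS⟩ := hup (Real.log a / 2) (by positivity)
    have hlt : 1 * Real.exp (Real.log a / 2) < a := by
      rw [one_mul, ← Real.lt_log_iff_exp_lt (by linarith)]
      linarith
    filter_upwards [((hroot A hA).mul_const _).eventually_lt_const hlt, eventually_gt_atTop 0]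
      with n hn hn0
    refine lt_of_le_of_lt ?_ hn
    have hn0' : (n : ℝ) ≠ 0 := by positivity
    calc S n ^ ((1 : ℝ) / (n : ℝ)) ≤ (A * Real.exp (n * (Real.log a / 2))) ^ ((1 : ℝ) / (n : ℝ)) :=
          Real.rpow_le_rpow (hc.le.trans (hlow n)) (hS n) (by positivity)
      _ = A ^ ((1 : ℝ) / (n : ℝ)) * Real.exp (Real.log a / 2) := by
          rw [Real.mul_rpow hA.le (Real.exp_pos _).le, ← Real.exp_mul]
          congr 2
          field_simp

theorem IsBergmanSystem.setIntegral_norm_eval_sq {G : Set ℂ} {P : ℕ → ℂ[X]} {lam : ℕ → ℝ}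
    (hP : IsBergmanSystem G P lam) (n : ℕ) : ∫ z in G, ‖(P n).eval z‖ ^ 2 = 1 := by
  have h := hP.2.2 n n
  simp only [Complex.mul_conj, Complex.normSq_eq_norm_sq, if_true] at h
  exact Complex.ofReal_injective (integral_ofReal.symm.trans h)

/-- The sup norms of the Bergman polynomials on the closure of `G` have `n`-th root limit 1. -/
theorem stmt6 (N : ℕ) (hN : 1 ≤ N) (Gs : Fin N → Set ℂ) (hArch : IsArchipelago Gs)
    (P : ℕ → Polynomial ℂ) (lam : ℕ → ℝ)
    (hP : IsBergmanSystem (⋃ j, Gs j) P lam) :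
    Tendsto (fun n : ℕ =>
        (⨆ z ∈ closure (⋃ j, Gs j), ‖(P n).eval z‖) ^ ((1 : ℝ) / (n : ℝ)))
      atTop (nhds 1) := by
  have hdom := hArch.1
  have hopen : IsOpen (⋃ j, Gs j) := isOpen_iUnion fun j => (hdom j).isOpen
  have hbdd : Bornology.IsBounded (⋃ j, Gs j) :=
    Bornology.isBounded_iUnion.2 fun j => (hdom j).isBounded
  have hne : (⋃ j, Gs j).Nonempty :=
    (hdom ⟨0, hN⟩).isConnected.nonempty.mono (subset_iUnion Gs ⟨0, hN⟩)
  have hnorm := hP.setIntegral_norm_eval_sq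
  set G := ⋃ j, Gs j
  have hle : ∀ n, ∀ z ∈ closure G, ‖(P n).eval z‖ ≤ ⨆ z ∈ closure G, ‖(P n).eval z‖ := by
    intro n z hz
    obtain ⟨B, hB⟩ := hbdd.isCompact_closure.exists_bound_of_continuousOn
      (P n).continuous.continuousOn
    have hbd : BddAbove (range fun z => ⨆ _ : z ∈ closure G, ‖(P n).eval z‖) := by
      refine ⟨max B 0, ?_⟩
      rintro _ ⟨ζ, rfl⟩
      exact Real.iSup_le (fun h => (hB ζ h).trans (le_max_left _ _)) (le_max_right _ _)
    refine le_trans ?_ (le_ciSup hbd z)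
    simp [hz]
  have hvol : 0 < volume.real G :=
    ENNReal.toReal_pos (hopen.measure_pos volume hne).ne' hbdd.measure_lt_top.ne
  refine tendsto_rpow_one_div_one (c := (√(volume.real G))⁻¹) (by positivity) (fun n => ?_) ?_
  · set S := ⨆ z ∈ closure G, ‖(P n).eval z‖
    have hS : 0 ≤ S := Real.iSup_nonneg fun z => Real.iSup_nonneg fun _ => norm_nonneg _
    have h1 : 1 ≤ S ^ 2 * volume.real G := by
      rw [← hnorm n]
      calc ∫ z in G, ‖(P n).eval z‖ ^ 2 ≤ ∫ _ in G, S ^ 2 :=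
            setIntegral_mono_on (integrableOn_norm_eval_sq _ hbdd)
              (integrableOn_const hbdd.measure_lt_top.ne) hopen.measurableSet
              fun z hz => pow_le_pow_left₀ (norm_nonneg _) (hle n z (subset_closure hz)) 2
        _ = S ^ 2 * volume.real G := by
            rw [setIntegral_const, smul_eq_mul, mul_comm]
    rw [inv_le_iff_one_le_mul₀ (by positivity)]
    refine (one_le_sq_iff₀ (by positivity)).1 ?_
    rwa [mul_pow, Real.sq_sqrt hvol.le]
  · intro θ hθ
    choose A hA hbound using fun j =>
      exists_norm_eval_sq_le_of_isConnected (hdom j).isOpen (hdom j).isConnected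
        (hdom j).isBounded hθ
    have hsum : 0 < ∑ j, A j := Finset.sum_pos (fun j _ => hA j) ⟨⟨0, hN⟩, Finset.mem_univ _⟩
    refine ⟨√(∑ j, A j), by positivity, fun n => ?_⟩
    refine Real.iSup_le (fun z => Real.iSup_le (fun hz => ?_) (by positivity)) (by positivity)
    rw [closure_iUnion_of_finite, mem_iUnion] at hz
    obtain ⟨j, hj⟩ := hz
    refine le_of_sq_le_sq ?_ (by positivity)
    rw [mul_pow, Real.sq_sqrt hsum.le]
    refine (hbound j n (P n) (hP.1 n).le z hj).trans ?_
    gcongr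
    calc A j * ∫ w in Gs j, ‖(P n).eval w‖ ^ 2 ≤ A j * ∫ w in G, ‖(P n).eval w‖ ^ 2 := by
          refine mul_le_mul_of_nonneg_left ?_ (hA j).le
          exact setIntegral_mono_set (integrableOn_norm_eval_sq _ hbdd)
            (Eventually.of_forall fun _ => by positivity) (subset_iUnion Gs j).eventuallyLE
      _ = A j := by rw [hnorm, mul_one]
      _ ≤ ∑ j, A j := Finset.single_le_sum (fun j _ => (hA j).le) (Finset.mem_univ j)
end
end
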